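/- arXiv:math/0005150 — 2 statements merged into one kernel-verified Lean document; each statement's English description precedes it below -/
import Mathlib

section
/- (Commutative case of Corollary 3.5.) Let (Ω, μ) be an atomless probability space, 1 ≤ p < 2, and let (f_n) be a bounded unconditional sequence in L^p(μ). Then the following are equivalent: (a) for every subsequence (f'_n) of (f_n), lim_{n→∞} n^{-1/p} ‖∑_{i=1}^n f'_i‖_{L^p(μ)} = 0; (b) the family (|f_n|^p)_{n∈ℕ} is uniformly integrable. -/
open MeasureTheory Filter
open scoped ENNReal NNReal BigOperators

noncomputable section

variable {E : Type*} [NormedAddCommGroup E] [NormedSpace ℝ E]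

/-- `x` is `K`-equivalent to the usual `ℓ^q` basis. -/
def IsLqBasisEquiv (q K : ℝ) (x : ℕ → E) : Prop :=
  ∀ (s : Finset ℕ) (a : ℕ → ℝ),
    (1 / K) * (∑ k ∈ s, |a k| ^ q) ^ (1 / q) ≤ ‖∑ k ∈ s, a k • x k‖ ∧
      ‖∑ k ∈ s, a k • x k‖ ≤ K * (∑ k ∈ s, |a k| ^ q) ^ (1 / q)

/-- `x` is `K`-equivalent to the usual `ℓ^q_n` basis. -/
def IsLqBasisEquivFin (q K : ℝ) {n : ℕ} (x : Fin n → E) : Prop :=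
  ∀ a : Fin n → ℝ,
    (1 / K) * (∑ k, |a k| ^ q) ^ (1 / q) ≤ ‖∑ k, a k • x k‖ ∧
      ‖∑ k, a k • x k‖ ≤ K * (∑ k, |a k| ^ q) ^ (1 / q)

/-- `x` is `u`-unconditional. -/
def IsUnconditionalWith (u : ℝ) (x : ℕ → E) : Prop :=
  ∀ (s : Finset ℕ) (c ε : ℕ → ℝ), (∀ k ∈ s, |ε k| = 1) →
    ‖∑ k ∈ s, (ε k * c k) • x k‖ ≤ u * ‖∑ k ∈ s, c k • x k‖

/-- `x` is unconditional. -/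
def IsUnconditional (x : ℕ → E) : Prop :=
  ∃ u : ℝ, 1 ≤ u ∧ IsUnconditionalWith u x

/-- Finite version of `u`-unconditionality. -/
def IsUnconditionalWithFin (u : ℝ) {n : ℕ} (x : Fin n → E) : Prop :=
  ∀ (c ε : Fin n → ℝ), (∀ k, |ε k| = 1) →
    ‖∑ k, (ε k * c k) • x k‖ ≤ u * ‖∑ k, c k • x k‖

/-- The measure `μ` is atomless: every measurable set of positive measure contains a
measurable subset of strictly smaller positive measure. -/
def Atomless {Ω : Type*} [MeasurableSpace Ω] (μ : Measure Ω) : Prop :=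
  ∀ A : Set Ω, MeasurableSet A → 0 < μ A →
    ∃ B, B ⊆ A ∧ MeasurableSet B ∧ 0 < μ B ∧ μ B < μ A

/-- The family `(|f n|^p)` is uniformly integrable. -/
def UnifIntPow {Ω : Type*} [MeasurableSpace Ω] (μ : Measure Ω) (p : ℝ) (f : ℕ → Ω → ℝ) : Prop :=
  ∀ ε : ℝ, 0 < ε → ∃ δ : ℝ, 0 < δ ∧ ∀ n, ∀ A : Set Ω, MeasurableSet A →
    μ A ≤ ENNReal.ofReal δ → ∫ x in A, |f n x| ^ p ∂μ ≤ ε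

/-- `(f n)` is weakly null in `L^p(μ)`. -/
def WeaklyNullLp {Ω : Type*} [MeasurableSpace Ω] (μ : Measure Ω) (p : ℝ≥0∞)
    (f : ℕ → Lp ℝ p μ) : Prop :=
  ∀ q : ℝ≥0∞, p⁻¹ + q⁻¹ = 1 → ∀ g : Lp ℝ q μ,
    Tendsto (fun n => ∫ x, (f n : Ω → ℝ) x * (g : Ω → ℝ) x ∂μ) atTop (nhds 0)

/-- The `p`-modulus of uniform integrability. -/
def omegaP {Ω : Type*} [MeasurableSpace Ω] (μ : Measure Ω) (p : ℝ) (f : Ω → ℝ) (ε : ℝ) : ℝ :=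
  sSup {r : ℝ | ∃ A : Set Ω, MeasurableSet A ∧ μ A ≤ ENNReal.ofReal ε ∧
    r = (∫ x in A, |f x| ^ p ∂μ) ^ (1 / p)}

/-- The sum over `s` of the reals `a i`, with sign `+` for `i ∈ t` and `-` otherwise. -/
def signedSum (s t : Finset ℕ) (a : ℕ → ℝ) : ℝ :=
  ∑ i ∈ s, (if i ∈ t then 1 else -1 : ℝ) * a i

lemma signedSum_insert_left {s t : Finset ℕ} {b : ℕ} (hb : b ∉ s) (ht : t ⊆ s) (a : ℕ → ℝ) :
    signedSum (insert b s) t a = signedSum s t a - a b := by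
  have hbt : b ∉ t := fun h => hb (ht h)
  simp only [signedSum, Finset.sum_insert hb, hbt, if_false]
  ring

lemma signedSum_insert_insert {s : Finset ℕ} {b : ℕ} (hb : b ∉ s) (t : Finset ℕ) (a : ℕ → ℝ) :
    signedSum (insert b s) (insert b t) a = signedSum s t a + a b := by
  have h : ∀ i ∈ s, (if i ∈ insert b t then 1 else -1 : ℝ) * a i =
      (if i ∈ t then 1 else -1 : ℝ) * a i := by
    intro i hi
    have : i ≠ b := fun h => hb (h ▸ hi)
    simp [Finset.mem_insert, this]
  rw [signedSum, Finset.sum_insert hb, Finset.sum_congr rfl h, signedSum]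
  simp
  ring

lemma sum_powerset_insert_signedSum {s : Finset ℕ} {b : ℕ} (hb : b ∉ s) (a : ℕ → ℝ)
    (F : ℝ → ℝ) :
    ∑ t ∈ (insert b s).powerset, F (signedSum (insert b s) t a) =
      ∑ t ∈ s.powerset, (F (signedSum s t a - a b) + F (signedSum s t a + a b)) := by
  rw [Finset.sum_powerset_insert hb, ← Finset.sum_add_distrib]
  refine Finset.sum_congr rfl fun t ht => ?_
  rw [signedSum_insert_left hb (Finset.mem_powerset.1 ht), signedSum_insert_insert hb]

lemma sum_signedSum_sq (s : Finset ℕ) (a : ℕ → ℝ) :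
    ∑ t ∈ s.powerset, signedSum s t a ^ 2 = 2 ^ s.card * ∑ i ∈ s, a i ^ 2 := by
  induction s using Finset.induction_on with
  | empty => simp [signedSum]
  | insert b s hb ih =>
    have h : ∀ t ∈ s.powerset, (signedSum s t a - a b) ^ 2 + (signedSum s t a + a b) ^ 2 =
        2 * signedSum s t a ^ 2 + 2 * a b ^ 2 := fun t _ => by ring
    rw [sum_powerset_insert_signedSum hb a (fun y => y ^ 2), Finset.sum_congr rfl h,
      Finset.sum_add_distrib, ← Finset.mul_sum, ih, Finset.card_insert_of_notMem hb,
      Finset.sum_insert hb, Finset.sum_const, Finset.card_powerset, nsmul_eq_mul]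
    push_cast
    ring

/-- Upper Khintchine inequality, for `0 < p ≤ 2`. -/
lemma sum_abs_signedSum_rpow_le {p : ℝ} (hp : 0 < p) (hp2 : p ≤ 2) (s : Finset ℕ) (a : ℕ → ℝ) :
    ∑ t ∈ s.powerset, |signedSum s t a| ^ p ≤ 2 ^ s.card * (∑ i ∈ s, a i ^ 2) ^ (p / 2) := by
  have hN : (0 : ℝ) < 2 ^ s.card := by positivity
  have h := Real.rpow_arith_mean_le_arith_mean_rpow s.powerset (fun _ => ((2 : ℝ) ^ s.card)⁻¹)
    (fun t => |signedSum s t a| ^ p) (fun _ _ => by positivity)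
    (by simp [Finset.card_powerset]) (fun _ _ => by positivity)
    (p := 2 / p) (by rwa [le_div_iff₀ hp, one_mul])
  have h2 : ∀ t ∈ s.powerset, ((2 : ℝ) ^ s.card)⁻¹ * (|signedSum s t a| ^ p) ^ (2 / p) =
      ((2 : ℝ) ^ s.card)⁻¹ * signedSum s t a ^ 2 := by
    intro t _
    rw [← Real.rpow_mul (abs_nonneg _), mul_div_cancel₀ _ hp.ne', Real.rpow_two, sq_abs]
  rw [Finset.sum_congr rfl h2, ← Finset.mul_sum, ← Finset.mul_sum, sum_signedSum_sq,
    inv_mul_cancel_left₀ hN.ne'] at h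
  have h0 : 0 ≤ ((2 : ℝ) ^ s.card)⁻¹ * ∑ t ∈ s.powerset, |signedSum s t a| ^ p := by positivity
  have h3 := Real.rpow_le_rpow (by positivity) h (by positivity : 0 ≤ p / 2)
  rw [← Real.rpow_mul h0, div_mul_div_cancel₀ hp.ne', div_self two_ne_zero, Real.rpow_one,
    inv_mul_le_iff₀ hN] at h3
  exact h3

/-- The sign averages of `|∑ ± a i| ^ p` dominate each `|a j| ^ p`. -/
lemma le_sum_abs_signedSum_rpow {p : ℝ} (hp : 1 ≤ p) {s : Finset ℕ} {j : ℕ} (hj : j ∈ s)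
    (a : ℕ → ℝ) : 2 ^ s.card * |a j| ^ p ≤ ∑ t ∈ s.powerset, |signedSum s t a| ^ p := by
  obtain ⟨r, hr, rfl⟩ : ∃ r, j ∉ r ∧ insert j r = s :=
    ⟨s.erase j, Finset.notMem_erase _ _, Finset.insert_erase hj⟩
  rw [sum_powerset_insert_signedSum hr a (fun y => |y| ^ p), Finset.card_insert_of_notMem hr]
  have key : ∀ x y : ℝ, 2 * |y| ^ p ≤ |x - y| ^ p + |x + y| ^ p := by
    intro x y
    have h := (convexOn_rpow hp).2 (abs_nonneg (x - y)) (abs_nonneg (x + y))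
      (by norm_num : (0 : ℝ) ≤ 1 / 2) (by norm_num : (0 : ℝ) ≤ 1 / 2) (by norm_num)
    simp only [smul_eq_mul] at h
    have h1 : |y| ≤ 1 / 2 * |x - y| + 1 / 2 * |x + y| := by
      have := abs_sub (x + y) (x - y)
      rw [show x + y - (x - y) = 2 * y by ring, abs_mul, abs_two] at this
      linarith
    have h2 := Real.rpow_le_rpow (abs_nonneg y) h1 (by linarith : 0 ≤ p)
    linarith
  calc (2 : ℝ) ^ (r.card + 1) * |a j| ^ p = ∑ t ∈ r.powerset, 2 * |a j| ^ p := by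
        rw [Finset.sum_const, Finset.card_powerset, nsmul_eq_mul]; push_cast; ring
    _ ≤ _ := Finset.sum_le_sum fun t _ => key _ _

lemma rpow_add_le_of_le_one {q : ℝ} (hq : 0 ≤ q) (hq1 : q ≤ 1) {x y : ℝ} (hx : 0 ≤ x)
    (hy : 0 ≤ y) : (x + y) ^ q ≤ x ^ q + y ^ q := by
  lift x to ℝ≥0 using hx
  lift y to ℝ≥0 using hy
  exact_mod_cast NNReal.rpow_add_le_add_rpow x y hq hq1

lemma rpow_sum_le_of_le_one {q : ℝ} (hq : 0 < q) (hq1 : q ≤ 1) (s : Finset ℕ) {x : ℕ → ℝ}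
    (hx : ∀ i, 0 ≤ x i) : (∑ i ∈ s, x i) ^ q ≤ ∑ i ∈ s, x i ^ q := by
  induction s using Finset.induction_on with
  | empty => simp [Real.zero_rpow hq.ne']
  | insert b s hb ih =>
    rw [Finset.sum_insert hb, Finset.sum_insert hb]
    have := rpow_add_le_of_le_one hq.le hq1 (hx b) (Finset.sum_nonneg fun i (_ : i ∈ s) => hx i)
    linarith

/-- Truncating at height `T` in the square function. -/
lemma rpow_sum_sq_le {p : ℝ} (hp : 0 < p) (hp2 : p ≤ 2) (s : Finset ℕ) (a : ℕ → ℝ) {T : ℝ}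
    (hT : 0 ≤ T) :
    (∑ i ∈ s, a i ^ 2) ^ (p / 2) ≤
      (s.card : ℝ) ^ (p / 2) * T ^ p + ∑ i ∈ s, if T < |a i| then |a i| ^ p else 0 := by
  have hsq : ∀ y : ℝ, 0 ≤ y → (y ^ 2) ^ (p / 2) = y ^ p := by
    intro y hy
    rw [← Real.rpow_two, ← Real.rpow_mul hy, mul_div_cancel₀ _ two_ne_zero]
  have h0 : ∀ i, 0 ≤ (if T < |a i| then a i ^ 2 else 0 : ℝ) := fun i => by
    split_ifs <;> positivity
  have h1 : ∑ i ∈ s, a i ^ 2 ≤ s.card * T ^ 2 + ∑ i ∈ s, if T < |a i| then a i ^ 2 else 0 := by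
    rw [← nsmul_eq_mul, ← Finset.sum_const, ← Finset.sum_add_distrib]
    refine Finset.sum_le_sum fun i _ => ?_
    split_ifs with h
    · nlinarith [sq_nonneg T]
    · rw [add_zero, ← sq_abs]
      exact pow_le_pow_left₀ (abs_nonneg _) (not_lt.1 h) 2
  refine (Real.rpow_le_rpow (by positivity) h1 (by positivity)).trans ?_
  refine (rpow_add_le_of_le_one (by positivity) (by linarith) (by positivity)
    (Finset.sum_nonneg fun i _ => h0 i)).trans ?_
  rw [Real.mul_rpow (by positivity) (by positivity), hsq T hT]
  gcongr
  refine (rpow_sum_le_of_le_one (by positivity) (by linarith) s h0).trans_eq ?_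
  refine Finset.sum_congr rfl fun i _ => ?_
  split_ifs
  · rw [← sq_abs, hsq _ (abs_nonneg _)]
  · rw [Real.zero_rpow (by positivity)]

section LpSums

variable {Ω : Type*} [MeasurableSpace Ω] {μ : Measure Ω} {p : ℝ}

lemma Lp_norm_rpow_eq_integral (hp : 0 < p) (g : Lp ℝ (ENNReal.ofReal p) μ) :
    ‖g‖ ^ p = ∫ x, |g x| ^ p ∂μ := by
  have h0 : ENNReal.ofReal p ≠ 0 := by simpa using hp
  rw [Lp.norm_def, (Lp.memLp g).eLpNorm_eq_integral_rpow_norm h0 ENNReal.ofReal_ne_top,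
    ENNReal.toReal_ofReal hp.le, ENNReal.toReal_ofReal (by positivity),
    ← Real.rpow_mul (integral_nonneg fun x => by positivity), inv_mul_cancel₀ hp.ne', Real.rpow_one]
  rfl

lemma Lp_integrable_abs_rpow (hp : 0 < p) (g : Lp ℝ (ENNReal.ofReal p) μ) :
    Integrable (fun x => |g x| ^ p) μ := by
  have h := (Lp.memLp g).integrable_norm_rpow (by simpa using hp) ENNReal.ofReal_ne_top
  rwa [ENNReal.toReal_ofReal hp.le] at h

lemma signedSum_coeFn (f : ℕ → Lp ℝ (ENNReal.ofReal p) μ) (s t : Finset ℕ) :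
    (∑ i ∈ s, (if i ∈ t then 1 else -1 : ℝ) • f i : Lp ℝ (ENNReal.ofReal p) μ) =ᵐ[μ]
      fun x => signedSum s t fun i => f i x := by
  have h : ∀ᵐ x ∂μ, ∀ i, ((if i ∈ t then 1 else -1 : ℝ) • f i : Lp ℝ (ENNReal.ofReal p) μ) x =
      (if i ∈ t then 1 else -1 : ℝ) * f i x :=
    ae_all_iff.2 fun i => Lp.coeFn_smul _ (f i)
  filter_upwards [Lp.coeFn_fun_finsetSum s fun i => (if i ∈ t then 1 else -1 : ℝ) • f i, h]
    with x hx hx'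
  rw [hx, signedSum]
  exact Finset.sum_congr rfl fun i _ => hx' i

lemma integrable_abs_signedSum_rpow (hp : 0 < p) (f : ℕ → Lp ℝ (ENNReal.ofReal p) μ)
    (s t : Finset ℕ) : Integrable (fun x => |signedSum s t fun i => f i x| ^ p) μ := by
  refine (Lp_integrable_abs_rpow hp
    (∑ i ∈ s, (if i ∈ t then 1 else -1 : ℝ) • f i)).congr ((signedSum_coeFn f s t).mono fun x hx => ?_)
  simp only [hx]

lemma norm_signedSum_rpow (hp : 0 < p) (f : ℕ → Lp ℝ (ENNReal.ofReal p) μ) (s t : Finset ℕ) :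
    ‖∑ i ∈ s, (if i ∈ t then 1 else -1 : ℝ) • f i‖ ^ p =
      ∫ x, |signedSum s t fun i => f i x| ^ p ∂μ := by
  rw [Lp_norm_rpow_eq_integral hp]
  exact integral_congr_ae ((signedSum_coeFn f s t).mono fun x hx => by simp only [hx])

lemma abs_sign_ite (t : Finset ℕ) (i : ℕ) : |(if i ∈ t then 1 else -1 : ℝ)| = 1 := by
  split_ifs <;> simp

lemma rpow_neg_inv_mul_rpow (hp : 0 < p) (n : ℕ) {y : ℝ} (hy : 0 ≤ y) :
    ((n : ℝ) ^ (-(1 / p)) * y) ^ p = (n : ℝ)⁻¹ * y ^ p := by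
  rw [Real.mul_rpow (by positivity) hy, ← Real.rpow_mul (by positivity), neg_mul,
    one_div_mul_cancel hp.ne', Real.rpow_neg_one]

/-- A single function with integrable `p`-th power has uniformly small integrals on small sets. -/
lemma exists_forall_setIntegral_le (hp : 0 < p) (g : Lp ℝ (ENNReal.ofReal p) μ) {ε : ℝ}
    (hε : 0 < ε) : ∃ δ : ℝ, 0 < δ ∧ ∀ A : Set Ω, μ A ≤ ENNReal.ofReal δ →
      ∫ x in A, |g x| ^ p ∂μ ≤ ε := by
  have hg := Lp_integrable_abs_rpow hp g
  obtain ⟨δ, hδ, H⟩ := exists_pos_setLIntegral_lt_of_measure_lt (μ := μ)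
    (f := fun x => ENNReal.ofReal (|g x| ^ p)) (ε := ENNReal.ofReal ε)
    (hg.lintegral_lt_top.ne) (by simpa using hε)
  obtain ⟨r, hr0, hr⟩ := ENNReal.lt_iff_exists_real_btwn.1 hδ
  refine ⟨r, by simpa using hr.1, fun A hA => ?_⟩
  rw [integral_eq_lintegral_of_nonneg_ae (ae_of_all _ fun x => by positivity)
    hg.aestronglyMeasurable.restrict]
  exact ENNReal.toReal_le_of_le_ofReal hε.le (H A (hA.trans_lt hr.2)).le

lemma exists_forall_lt_setIntegral_le (hp : 0 < p) (f : ℕ → Lp ℝ (ENNReal.ofReal p) μ) (N : ℕ)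
    {ε : ℝ} (hε : 0 < ε) : ∃ δ : ℝ, 0 < δ ∧ ∀ m < N, ∀ A : Set Ω, μ A ≤ ENNReal.ofReal δ →
      ∫ x in A, |f m x| ^ p ∂μ ≤ ε := by
  induction N with
  | zero => exact ⟨1, one_pos, fun m hm => absurd hm (Nat.not_lt_zero m)⟩
  | succ N ih =>
    obtain ⟨δ₁, h₁, H₁⟩ := ih
    obtain ⟨δ₂, h₂, H₂⟩ := exists_forall_setIntegral_le hp (f N) hε
    refine ⟨min δ₁ δ₂, lt_min h₁ h₂, fun m hm A hA => ?_⟩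
    rcases Nat.lt_succ_iff_lt_or_eq.1 hm with hm | rfl
    · exact H₁ m hm A (hA.trans (ENNReal.ofReal_le_ofReal (min_le_left _ _)))
    · exact H₂ A (hA.trans (ENNReal.ofReal_le_ofReal (min_le_right _ _)))

/-- If `|f n| ^ p` is not uniformly integrable, a subsequence keeps a fixed amount of mass on
sets which are negligible for the earlier terms. -/
lemma exists_strictMono_of_not_unifIntPow (hp : 0 < p) {f : ℕ → Lp ℝ (ENNReal.ofReal p) μ}
    (h : ¬ UnifIntPow μ p fun n => (f n : Ω → ℝ)) :
    ∃ (ε : ℝ) (k : ℕ → ℕ) (A : ℕ → Set Ω), 0 < ε ∧ StrictMono k ∧ (∀ j, MeasurableSet (A j)) ∧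
      (∀ j, ε ≤ ∫ x in A j, |f (k j) x| ^ p ∂μ) ∧
      ∀ i j, i < j → ∫ x in A j, |f (k i) x| ^ p ∂μ ≤ ε / 4 * (1 / 2) ^ j := by
  simp only [UnifIntPow, not_forall, not_exists, not_and, not_le] at h
  obtain ⟨ε, hε, h⟩ := h
  have step : ∀ N j : ℕ, ∃ (n : ℕ) (A : Set Ω), N ≤ n ∧ MeasurableSet A ∧
      ε ≤ ∫ x in A, |f n x| ^ p ∂μ ∧
      ∀ m < N, ∫ x in A, |f m x| ^ p ∂μ ≤ ε / 4 * (1 / 2) ^ j := by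
    intro N j
    obtain ⟨δ, hδ, H⟩ := exists_forall_lt_setIntegral_le hp f N
      (by positivity : 0 < ε / 4 * (1 / 2) ^ j)
    obtain ⟨n, A, hA, hAδ, hn⟩ := h δ hδ
    refine ⟨n, A, not_lt.1 fun hlt => ?_, hA, hn.le, fun m hm => H m hm A hAδ⟩
    have h1 := H n hlt A hAδ
    have h2 : ((1 : ℝ) / 2) ^ j ≤ 1 := pow_le_one₀ (by norm_num) (by norm_num)
    nlinarith
  choose ν α hν hα hmass hsmall using step
  let N : ℕ → ℕ := fun j => Nat.rec 0 (fun j N => ν N j + 1) j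
  have hN : ∀ j, N (j + 1) = ν (N j) j + 1 := fun j => rfl
  have hNmono : Monotone N := monotone_nat_of_le_succ fun j => by
    rw [hN]; exact (hν _ _).trans (Nat.le_succ _)
  refine ⟨ε, fun j => ν (N j) j, fun j => α (N j) j, hε, strictMono_nat_of_lt_succ fun j => ?_,
    fun j => hα _ _, fun j => hmass _ _, fun i j hij => hsmall _ _ _ ?_⟩
  · exact (Nat.lt_succ_self _).trans_le ((hN j).symm.le.trans (hν _ _))
  · exact (Nat.lt_succ_self _).trans_le ((hN i).symm.le.trans (hNmono hij))

/-- Removing the later sets `A l` from `A j` costs at most half of the mass. -/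
lemma half_le_setIntegral_diff (hp : 0 < p) {g : Lp ℝ (ENNReal.ofReal p) μ} {A : ℕ → Set Ω}
    (hA : ∀ j, MeasurableSet (A j)) {ε : ℝ} (hε : 0 < ε) (j n : ℕ)
    (hmass : ε ≤ ∫ x in A j, |g x| ^ p ∂μ)
    (hsmall : ∀ l, j < l → ∫ x in A l, |g x| ^ p ∂μ ≤ ε / 4 * (1 / 2) ^ l) :
    ε / 2 ≤ ∫ x in A j \ ⋃ l ∈ Finset.Ioo j n, A l, |g x| ^ p ∂μ := by
  have hg := Lp_integrable_abs_rpow hp g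
  have hgA : ∀ l x, 0 ≤ (A l).indicator (fun x => |g x| ^ p) x := fun l x =>
    Set.indicator_nonneg (fun y _ => by positivity) x
  have hB : MeasurableSet (A j \ ⋃ l ∈ Finset.Ioo j n, A l) :=
    (hA j).diff (Finset.measurableSet_biUnion _ fun l _ => hA l)
  have h1 : ∫ x in A j, |g x| ^ p ∂μ ≤ ∫ x in A j \ ⋃ l ∈ Finset.Ioo j n, A l, |g x| ^ p ∂μ +
      ∑ l ∈ Finset.Ioo j n, ∫ x in A l, |g x| ^ p ∂μ := by
    simp only [← integral_indicator hB, ← integral_indicator (hA _)]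
    rw [← integral_finsetSum _ fun l _ => hg.indicator (hA l), ← integral_add (hg.indicator hB)
      (integrable_finsetSum _ fun l _ => hg.indicator (hA l))]
    refine integral_mono (hg.indicator (hA j)) ((hg.indicator hB).add
      (integrable_finsetSum _ fun l _ => hg.indicator (hA l))) fun x => ?_
    by_cases hx : x ∈ A j
    · by_cases hxl : x ∈ ⋃ l ∈ Finset.Ioo j n, A l
      · obtain ⟨l, hl, hxl'⟩ := Set.mem_iUnion₂.1 hxl
        have := Finset.single_le_sum (f := fun l => (A l).indicator (fun x => |g x| ^ p) x)
          (fun l _ => hgA l x) hl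
        have hxB : x ∉ A j \ ⋃ l ∈ Finset.Ioo j n, A l := fun h => h.2 hxl
        rw [Set.indicator_of_mem hxl'] at this
        rwa [Set.indicator_of_mem hx, Set.indicator_of_notMem hxB, zero_add]
      · have := Finset.sum_nonneg fun l (_ : l ∈ Finset.Ioo j n) => hgA l x
        have hxB : x ∈ A j \ ⋃ l ∈ Finset.Ioo j n, A l := ⟨hx, hxl⟩
        rw [Set.indicator_of_mem hx, Set.indicator_of_mem hxB]
        linarith
    · rw [Set.indicator_of_notMem hx]
      exact add_nonneg (Set.indicator_nonneg (fun y _ => by positivity) x)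
        (Finset.sum_nonneg fun l _ => hgA l x)
  have h2 : ∑ l ∈ Finset.Ioo j n, ∫ x in A l, |g x| ^ p ∂μ ≤ ε / 4 * 2 := by
    calc _ ≤ ∑ l ∈ Finset.Ioo j n, ε / 4 * (1 / 2 : ℝ) ^ l :=
          Finset.sum_le_sum fun l hl => hsmall l (Finset.mem_Ioo.1 hl).1
      _ ≤ ∑ l ∈ Finset.range n, ε / 4 * (1 / 2 : ℝ) ^ l :=
          Finset.sum_le_sum_of_subset_of_nonneg
            (fun l hl => Finset.mem_range.2 (Finset.mem_Ioo.1 hl).2) fun l _ _ => by positivity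
      _ ≤ ε / 4 * 2 := by
          rw [← Finset.mul_sum]
          gcongr
          exact sum_geometric_two_le n
  linarith

variable [Fact (1 ≤ ENNReal.ofReal p)] {u : ℝ} {f : ℕ → Lp ℝ (ENNReal.ofReal p) μ}

lemma IsUnconditionalWith.norm_sum_rpow_le (hf : IsUnconditionalWith u f) (hu : 0 ≤ u)
    (hp : 0 < p) (s : Finset ℕ) :
    2 ^ s.card * ‖∑ i ∈ s, f i‖ ^ p ≤
      u ^ p * ∫ x, ∑ t ∈ s.powerset, |signedSum s t fun i => f i x| ^ p ∂μ := by
  rw [integral_finsetSum _ fun t _ => integrable_abs_signedSum_rpow hp f s t, Finset.mul_sum]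
  calc (2 : ℝ) ^ s.card * ‖∑ i ∈ s, f i‖ ^ p
      = ∑ t ∈ s.powerset, ‖∑ i ∈ s, f i‖ ^ p := by
        rw [Finset.sum_const, Finset.card_powerset, nsmul_eq_mul]; push_cast; ring
    _ ≤ _ := Finset.sum_le_sum fun t _ => ?_
  rw [← norm_signedSum_rpow hp, ← Real.mul_rpow hu (norm_nonneg _)]
  refine Real.rpow_le_rpow (norm_nonneg _) ?_ hp.le
  refine le_of_eq_of_le ?_ (hf s (fun i => if i ∈ t then 1 else -1)
    (fun i => if i ∈ t then 1 else -1) fun i _ => abs_sign_ite t i)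
  congr 1
  refine Finset.sum_congr rfl fun i _ => ?_
  split_ifs <;> simp

lemma IsUnconditionalWith.integral_le_norm_sum_rpow (hf : IsUnconditionalWith u f) (hu : 0 ≤ u)
    (hp : 0 < p) (s : Finset ℕ) :
    ∫ x, ∑ t ∈ s.powerset, |signedSum s t fun i => f i x| ^ p ∂μ ≤
      2 ^ s.card * (u ^ p * ‖∑ i ∈ s, f i‖ ^ p) := by
  rw [integral_finsetSum _ fun t _ => integrable_abs_signedSum_rpow hp f s t]
  calc _ ≤ ∑ t ∈ s.powerset, u ^ p * ‖∑ i ∈ s, f i‖ ^ p := Finset.sum_le_sum fun t _ => ?_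
    _ = _ := by rw [Finset.sum_const, Finset.card_powerset, nsmul_eq_mul]; push_cast; ring
  rw [← norm_signedSum_rpow hp, ← Real.mul_rpow hu (norm_nonneg _)]
  refine Real.rpow_le_rpow (norm_nonneg _) ?_ hp.le
  have h := hf s (fun _ => 1) (fun i => if i ∈ t then 1 else -1) fun i _ => abs_sign_ite t i
  simpa only [mul_one, one_smul] using h

lemma IsUnconditionalWith.comp_injective (hf : IsUnconditionalWith u f) {k : ℕ → ℕ}
    (hk : k.Injective) : IsUnconditionalWith u (f ∘ k) := by
  intro s c ε hε
  have h := hf (s.map ⟨k, hk⟩) (c ∘ Function.invFun k) (ε ∘ Function.invFun k) (by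
    simpa [Function.leftInverse_invFun hk _] using hε)
  simpa [Function.leftInverse_invFun hk _] using h

/-- Upper estimate for sums of an unconditional sequence, by truncation at height `T`. -/
lemma IsUnconditionalWith.norm_sum_rpow_le_truncation (hf : IsUnconditionalWith u f) (hu : 0 ≤ u)
    [IsProbabilityMeasure μ] (hp : 0 < p) (hp2 : p ≤ 2) (s : Finset ℕ) {T : ℝ} (hT : 0 ≤ T) :
    ‖∑ i ∈ s, f i‖ ^ p ≤
      u ^ p * ((s.card : ℝ) ^ (p / 2) * T ^ p + ∑ i ∈ s, ∫ x in {x | T < |f i x|}, |f i x| ^ p ∂μ) := by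
  have hm : ∀ i, MeasurableSet {x | T < |f i x|} := fun i =>
    measurableSet_lt measurable_const (Lp.stronglyMeasurable (f i)).measurable.abs
  have hind : ∀ i x, (if T < |f i x| then |f i x| ^ p else 0) =
      {x | T < |f i x|}.indicator (fun x => |f i x| ^ p) x := fun i x => by
    simp [Set.indicator_apply]
  have hint : ∀ i, Integrable ({x | T < |f i x|}.indicator (fun x => |f i x| ^ p)) μ := fun i =>
    (Lp_integrable_abs_rpow hp (f i)).indicator (hm i)
  have h1 : ∫ x, ∑ t ∈ s.powerset, |signedSum s t fun i => f i x| ^ p ∂μ ≤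
      ∫ x, 2 ^ s.card * ((s.card : ℝ) ^ (p / 2) * T ^ p +
        ∑ i ∈ s, {x | T < |f i x|}.indicator (fun x => |f i x| ^ p) x) ∂μ := by
    refine integral_mono (integrable_finsetSum _ fun t _ => integrable_abs_signedSum_rpow hp f s t)
      (((integrable_const _).add (integrable_finsetSum _ fun i _ => hint i)).const_mul _)
      fun x => ?_
    refine (sum_abs_signedSum_rpow_le hp hp2 s _).trans ?_
    simp only [← hind]
    gcongr
    exact rpow_sum_sq_le hp hp2 s _ hT
  rw [integral_const_mul, integral_add (integrable_const _) (integrable_finsetSum _ fun i _ => hint i),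
    integral_finsetSum _ fun i _ => hint i, integral_const, probReal_univ, one_smul] at h1
  simp only [integral_indicator (hm _)] at h1
  have h2 := (hf.norm_sum_rpow_le hu hp s).trans (mul_le_mul_of_nonneg_left h1 (by positivity))
  rw [mul_left_comm] at h2
  exact le_of_mul_le_mul_left h2 (by positivity)

/-- Lower estimate for sums of an unconditional sequence with mass on disjoint sets. -/
lemma IsUnconditionalWith.sum_setIntegral_le_norm_sum_rpow (hf : IsUnconditionalWith u f)
    (hu : 0 ≤ u) (hp : 1 ≤ p) (s : Finset ℕ) {B : ℕ → Set Ω} (hB : ∀ i ∈ s, MeasurableSet (B i))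
    (hd : (s : Set ℕ).Pairwise (Function.onFun Disjoint B)) :
    ∑ i ∈ s, ∫ x in B i, |f i x| ^ p ∂μ ≤ u ^ p * ‖∑ i ∈ s, f i‖ ^ p := by
  have hp0 : 0 < p := by linarith
  have hG : Integrable (fun x => ∑ t ∈ s.powerset, |signedSum s t fun i => f i x| ^ p) μ :=
    integrable_finsetSum _ fun t _ => integrable_abs_signedSum_rpow hp0 f s t
  refine le_of_mul_le_mul_left ?_ (by positivity : (0 : ℝ) < 2 ^ s.card)
  refine le_trans ?_ (hf.integral_le_norm_sum_rpow hu hp0 s)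
  refine le_trans ?_ (setIntegral_le_integral (s := ⋃ i ∈ s, B i) hG
    (ae_of_all _ fun x => Finset.sum_nonneg fun t _ => by positivity))
  rw [integral_biUnion_finset s hB hd fun i _ => hG.integrableOn, Finset.mul_sum]
  refine Finset.sum_le_sum fun i hi => ?_
  rw [← integral_const_mul]
  exact integral_mono ((Lp_integrable_abs_rpow hp0 (f i)).integrableOn.const_mul _)
    hG.integrableOn fun x => le_sum_abs_signedSum_rpow hp hi fun j => f j x

lemma UnifIntPow.exists_truncation (h : UnifIntPow μ p fun n => (f n : Ω → ℝ)) (hp : 0 < p)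
    [IsProbabilityMeasure μ] {M : ℝ} (hM : ∀ n, ‖f n‖ ≤ M) {ε : ℝ} (hε : 0 < ε) :
    ∃ T : ℝ, 0 ≤ T ∧ ∀ n, ∫ x in {x | T < |f n x|}, |f n x| ^ p ∂μ ≤ ε := by
  obtain ⟨δ, hδ, H⟩ := h ε hε
  have hM0 : 0 ≤ M := (norm_nonneg _).trans (hM 0)
  have hK : 0 < M ^ p + 1 := by positivity
  refine ⟨((M ^ p + 1) / δ) ^ p⁻¹, by positivity, fun n => H n _
    (measurableSet_lt measurable_const (Lp.stronglyMeasurable (f n)).measurable.abs) ?_⟩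
  have hTp : (((M ^ p + 1) / δ) ^ p⁻¹) ^ p = (M ^ p + 1) / δ := by
    rw [← Real.rpow_mul (by positivity), inv_mul_cancel₀ hp.ne', Real.rpow_one]
  have h1 := mul_meas_ge_le_integral_of_nonneg (μ := μ) (f := fun x => |f n x| ^ p)
    (ae_of_all _ fun x => by positivity) (Lp_integrable_abs_rpow hp (f n)) ((M ^ p + 1) / δ)
  rw [← Lp_norm_rpow_eq_integral hp] at h1
  have h2 : ‖f n‖ ^ p ≤ M ^ p := Real.rpow_le_rpow (norm_nonneg _) (hM n) hp.le
  have h3 : μ.real {x | (M ^ p + 1) / δ ≤ |f n x| ^ p} ≤ δ := by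
    rw [div_mul_eq_mul_div, div_le_iff₀ hδ] at h1
    nlinarith
  have h4 : μ {x | ((M ^ p + 1) / δ) ^ p⁻¹ < |f n x|} ≤
      μ {x | (M ^ p + 1) / δ ≤ |f n x| ^ p} := by
    refine measure_mono fun x hx => ?_
    have := Real.rpow_le_rpow (by positivity) (show _ < |f n x| from hx).le hp.le
    rwa [hTp] at this
  refine h4.trans ?_
  rw [← ofReal_measureReal]
  exact ENNReal.ofReal_le_ofReal h3

/-- Uniform integrability of `|f n| ^ p` forces `‖f 0 + ⋯ + f (n - 1)‖ = o(n ^ (1 / p))`. -/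
lemma IsUnconditionalWith.tendsto_of_unifIntPow (hf : IsUnconditionalWith u f) (hu : 1 ≤ u)
    [IsProbabilityMeasure μ] (hp : 0 < p) (hp2 : p < 2) {M : ℝ} (hM : ∀ n, ‖f n‖ ≤ M)
    (h : UnifIntPow μ p fun n => (f n : Ω → ℝ)) :
    Tendsto (fun n : ℕ => (n : ℝ) ^ (-(1 / p)) * ‖∑ i ∈ Finset.range n, f i‖) atTop (nhds 0) := by
  have hup : 0 < u ^ p := by positivity
  suffices H : Tendsto (fun n : ℕ => (n : ℝ)⁻¹ * ‖∑ i ∈ Finset.range n, f i‖ ^ p)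
      atTop (nhds 0) by
    have h1 := H.rpow_const (p := 1 / p) (Or.inr (by positivity))
    rw [Real.zero_rpow (by positivity)] at h1
    refine h1.congr fun n => ?_
    rw [← rpow_neg_inv_mul_rpow hp n (norm_nonneg _), ← Real.rpow_mul (by positivity),
      mul_one_div_cancel hp.ne', Real.rpow_one]
  rw [Metric.tendsto_atTop']
  intro η hη
  obtain ⟨T, hT, HT⟩ := h.exists_truncation hp hM (ε := η / (2 * u ^ p)) (by positivity)
  have hlim : Tendsto (fun n : ℕ => u ^ p * ((n : ℝ) ^ (-(1 - p / 2)) * T ^ p)) atTop (nhds 0) := by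
    have := (((tendsto_rpow_neg_atTop (by linarith : 0 < 1 - p / 2)).comp
      tendsto_natCast_atTop_atTop).mul_const (T ^ p)).const_mul (u ^ p)
    simpa using this
  obtain ⟨N, hN⟩ := Metric.tendsto_atTop'.1 hlim (η / 2) (by positivity)
  refine ⟨N, fun n hn => ?_⟩
  have hn0 : (0 : ℝ) < n := by exact_mod_cast (Nat.zero_le N).trans_lt hn
  have h1 := hN n hn
  rw [Real.dist_0_eq_abs, abs_of_nonneg (by positivity)] at h1 ⊢
  have h2 := hf.norm_sum_rpow_le_truncation (by linarith) hp hp2.le (Finset.range n) hT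
  have h3 : ∑ i ∈ Finset.range n, ∫ x in {x | T < |f i x|}, |f i x| ^ p ∂μ ≤
      n * (η / (2 * u ^ p)) := by
    refine (Finset.sum_le_sum fun i _ => HT i).trans_eq ?_
    simp
  rw [Finset.card_range] at h2
  have h4 : ‖∑ i ∈ Finset.range n, f i‖ ^ p ≤
      u ^ p * ((n : ℝ) ^ (p / 2) * T ^ p + n * (η / (2 * u ^ p))) := h2.trans (by gcongr)
  have h5 : (n : ℝ) ^ (-(1 - p / 2)) = (n : ℝ)⁻¹ * (n : ℝ) ^ (p / 2) := by
    rw [← Real.rpow_neg_one, ← Real.rpow_add hn0]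
    congr 1
    ring
  calc (n : ℝ)⁻¹ * ‖∑ i ∈ Finset.range n, f i‖ ^ p
      ≤ (n : ℝ)⁻¹ * (u ^ p * ((n : ℝ) ^ (p / 2) * T ^ p + n * (η / (2 * u ^ p)))) := by gcongr
    _ = u ^ p * ((n : ℝ) ^ (-(1 - p / 2)) * T ^ p) + η / 2 := by
        rw [h5]
        field_simp
    _ < η := by linarith

/-- If `|f n| ^ p` is not uniformly integrable, some subsequence has sums of order at least
`n ^ (1 / p)`. -/
lemma IsUnconditionalWith.exists_subsequence_lower_bound (hf : IsUnconditionalWith u f)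
    (hu : 1 ≤ u) (hp : 1 ≤ p) (h : ¬ UnifIntPow μ p fun n => (f n : Ω → ℝ)) :
    ∃ (ε : ℝ) (k : ℕ → ℕ), 0 < ε ∧ StrictMono k ∧
      ∀ n : ℕ, n * ε ≤ u ^ p * ‖∑ i ∈ Finset.range n, f (k i)‖ ^ p := by
  have hp0 : 0 < p := by linarith
  obtain ⟨ε, k, A, hε, hk, hA, hmass, hsmall⟩ := exists_strictMono_of_not_unifIntPow hp0 h
  refine ⟨ε / 2, k, by positivity, hk, fun n => ?_⟩
  have hd : ((Finset.range n : Finset ℕ) : Set ℕ).Pairwise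
      (Function.onFun Disjoint fun j => A j \ ⋃ l ∈ Finset.Ioo j n, A l) := by
    have key : ∀ i j, i < j → j < n → Disjoint (A i \ ⋃ l ∈ Finset.Ioo i n, A l)
        (A j \ ⋃ l ∈ Finset.Ioo j n, A l) := fun i j hij hj =>
      Set.disjoint_left.2 fun x hx hx' =>
        hx.2 (Set.mem_iUnion₂.2 ⟨j, Finset.mem_Ioo.2 ⟨hij, hj⟩, hx'.1⟩)
    intro i hi j hj hij
    simp only [Finset.coe_range, Set.mem_Iio] at hi hj
    rcases lt_or_gt_of_ne hij with hij | hij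
    · exact key i j hij hj
    · exact (key j i hij hi).symm
  refine le_trans ?_ ((hf.comp_injective hk.injective).sum_setIntegral_le_norm_sum_rpow
    (by linarith) hp (Finset.range n)
    (fun j _ => (hA j).diff (Finset.measurableSet_biUnion _ fun l _ => hA l)) hd)
  calc n * (ε / 2) = ∑ i ∈ Finset.range n, ε / 2 := by simp
    _ ≤ _ := Finset.sum_le_sum fun j _ => half_le_setIntegral_diff hp0 hA hε j n (hmass j)
      fun l hl => hsmall j l hl

end LpSums

/-- (Commutative case of Corollary 3.5.) -/
theorem statement7
    {Ω : Type*} [MeasurableSpace Ω] (μ : Measure Ω) [IsProbabilityMeasure μ]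
    (hμ : Atomless μ)
    (p : ℝ) (hp1 : 1 ≤ p) (hp2 : p < 2)
    [Fact (1 ≤ ENNReal.ofReal p)]
    (f : ℕ → Lp ℝ (ENNReal.ofReal p) μ)
    (M : ℝ) (hM : ∀ n, ‖f n‖ ≤ M)
    (huncond : IsUnconditional f) :
    (∀ k : ℕ → ℕ, StrictMono k →
        Tendsto (fun n : ℕ => (n : ℝ) ^ (-(1 / p)) * ‖∑ i ∈ Finset.range n, f (k i)‖)
          atTop (nhds 0)) ↔
      UnifIntPow μ p fun n => (f n : Ω → ℝ) := by
  obtain ⟨u, hu, hf⟩ := huncond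
  have hp0 : 0 < p := by linarith
  constructor
  · intro H
    by_contra hUI
    obtain ⟨ε, k, hε, hk, hlow⟩ := hf.exists_subsequence_lower_bound hu hp1 hUI
    have h1 := (H k hk).rpow_const (p := p) (Or.inr hp0.le)
    rw [Real.zero_rpow hp0.ne'] at h1
    have h2 := h1.const_mul (u ^ p)
    rw [mul_zero] at h2
    refine absurd (ge_of_tendsto h2 (b := ε) ?_) (not_le.2 hε)
    filter_upwards [eventually_gt_atTop 0] with n hn
    have hn' : (0 : ℝ) < n := by exact_mod_cast hn
    rw [rpow_neg_inv_mul_rpow hp0 n (norm_nonneg _), mul_left_comm, ← div_eq_inv_mul,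
      le_div_iff₀ hn', mul_comm]
    exact hlow n
  · intro H k hk
    refine (hf.comp_injective hk.injective).tendsto_of_unifIntPow hu hp0 hp2
      (fun n => hM (k n)) fun ε hε => ?_
    obtain ⟨δ, hδ, hA⟩ := H ε hε
    exact ⟨δ, hδ, fun n => hA (k n)⟩

end
end

section
/- (Commutative case of the trichotomy Theorem 4.1.) Let (Ω, μ) be an atomless probability space, 1 ≤ p < 2, and let (x_{ij})_{i,j∈ℕ} be an infinite matrix in L^p(μ) which is semi-normalized (there are 0 < δ ≤ K < ∞ with δ ≤ ‖x_{ij}‖_{L^p(μ)} ≤ K for all i, j). Assume every column and every generalized diagonal of (x_{ij}) is unconditional, and there is u ≥ 1 such that every row is u-unconditional. Then at least one of the following holds: (I) some column (x_{ij})_{i∈ℕ} has a subsequence which is K'-equivalent to the usual ℓ^p basis for some K' ≥ 1; (II) there is C ≥ 1 such that for every n there exist a row index i and j_1 < ⋯ < j_n with (x_{i,j_1}, …, x_{i,j_n}) C-equivalent to the usual ℓ^p_n basis; (III) there is a generalized diagonal (y_k) such that lim_{n→∞} n^{-1/p} ‖∑_{i=1}^n y'_i‖_{L^p(μ)} = 0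 for every subsequence (y'_i) of (y_k). -/
open MeasureTheory Filter
open scoped ENNReal NNReal BigOperators

noncomputable section

variable {E : Type*} [NormedAddCommGroup E] [NormedSpace ℝ E]

/-- The sign vector that is `1` on `t` and `-1` off `t`. -/
def signOn (t : Finset ℕ) (k : ℕ) : ℝ := if k ∈ t then 1 else -1

lemma abs_signOn (t : Finset ℕ) (k : ℕ) : |signOn t k| = 1 := by
  unfold signOn; split_ifs <;> simp

lemma signOn_mul_self (t : Finset ℕ) (k : ℕ) : signOn t k * signOn t k = 1 := by
  unfold signOn; split_ifs <;> simp

lemma sum_signOn_insert {i : ℕ} {s t : Finset ℕ} (hi : i ∉ s) (a : ℕ → ℝ) :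
    ∑ k ∈ s, signOn (insert i t) k * a k = ∑ k ∈ s, signOn t k * a k := by
  refine Finset.sum_congr rfl fun k hk => ?_
  have : k ≠ i := fun h => hi (h ▸ hk)
  simp [signOn, this]

lemma sum_powerset_sq (s : Finset ℕ) (a : ℕ → ℝ) (b : ℝ) :
    ∑ t ∈ s.powerset, (b + ∑ k ∈ s, signOn t k * a k) ^ 2 =
      2 ^ s.card * (b ^ 2 + ∑ k ∈ s, a k ^ 2) := by
  induction s using Finset.induction_on generalizing b with
  | empty => simp
  | insert i s hi ih =>
    rw [Finset.sum_powerset_insert hi]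
    have h1 : ∀ t ∈ s.powerset, (b + ∑ k ∈ insert i s, signOn t k * a k) ^ 2 =
        ((b - a i) + ∑ k ∈ s, signOn t k * a k) ^ 2 := by
      intro t ht
      have hit : i ∉ t := fun h => hi (Finset.mem_powerset.1 ht h)
      rw [Finset.sum_insert hi]
      simp only [signOn, hit, if_false]
      ring
    have h2 : ∀ t ∈ s.powerset, (b + ∑ k ∈ insert i s, signOn (insert i t) k * a k) ^ 2 =
        ((b + a i) + ∑ k ∈ s, signOn t k * a k) ^ 2 := by
      intro t ht
      rw [Finset.sum_insert hi, sum_signOn_insert hi]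
      simp only [signOn, Finset.mem_insert_self, if_true]
      ring
    rw [Finset.sum_congr rfl h1, Finset.sum_congr rfl h2, ih, ih, Finset.card_insert_of_notMem hi,
      Finset.sum_insert hi]
    ring

lemma card_mul_abs_le_sum_powerset {s : Finset ℕ} {j : ℕ} (hj : j ∈ s) (a : ℕ → ℝ) :
    2 ^ s.card * |a j| ≤ ∑ t ∈ s.powerset, |∑ k ∈ s, signOn t k * a k| := by
  obtain ⟨s, hjs, rfl⟩ : ∃ s', j ∉ s' ∧ insert j s' = s :=
    ⟨s.erase j, by simp, Finset.insert_erase hj⟩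
  rw [Finset.sum_powerset_insert hjs, ← Finset.sum_add_distrib, Finset.card_insert_of_notMem hjs]
  have : ∀ t ∈ s.powerset, 2 * |a j| ≤ |∑ k ∈ insert j s, signOn t k * a k| +
      |∑ k ∈ insert j s, signOn (insert j t) k * a k| := by
    intro t ht
    have hit : j ∉ t := fun h => hjs (Finset.mem_powerset.1 ht h)
    rw [Finset.sum_insert hjs, Finset.sum_insert hjs, sum_signOn_insert hjs]
    simp only [signOn, hit, if_false, Finset.mem_insert_self, if_true]
    rw [show (2 : ℝ) * |a j| = |2 * a j| by simp [abs_mul]]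
    rw [add_comm]
    refine le_trans (le_of_eq ?_) (abs_sub _ _)
    congr 1; ring
  calc 2 ^ (s.card + 1) * |a j| = ∑ t ∈ s.powerset, 2 * |a j| := by
        rw [Finset.sum_const, Finset.card_powerset, nsmul_eq_mul]; push_cast; ring
    _ ≤ _ := Finset.sum_le_sum this

/-- Jensen's inequality for the uniform average over the subsets of `s`. -/
lemma rpow_sum_powerset_le (s : Finset ℕ) {q : ℝ} (hq : 1 ≤ q) (g : Finset ℕ → ℝ)
    (hg : ∀ t, 0 ≤ g t) :
    (∑ t ∈ s.powerset, g t / 2 ^ s.card) ^ q ≤ ∑ t ∈ s.powerset, g t ^ q / 2 ^ s.card := by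
  have h := Real.rpow_arith_mean_le_arith_mean_rpow s.powerset (fun _ => 1 / (2 : ℝ) ^ s.card) g
    (fun _ _ => by positivity)
    (by rw [Finset.sum_const, Finset.card_powerset, nsmul_eq_mul]; push_cast; field_simp)
    (fun t _ => hg t) hq
  simpa only [div_mul_eq_mul_div, one_mul] using h

lemma rpow_abs_le_average {s : Finset ℕ} {j : ℕ} (hj : j ∈ s) (a : ℕ → ℝ) {p : ℝ} (hp : 1 ≤ p) :
    |a j| ^ p ≤ ∑ t ∈ s.powerset, |∑ k ∈ s, signOn t k * a k| ^ p / 2 ^ s.card := by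
  refine le_trans ?_ (rpow_sum_powerset_le s hp _ fun t => abs_nonneg _)
  refine Real.rpow_le_rpow (abs_nonneg _) ?_ (by linarith)
  rw [← Finset.sum_div, le_div_iff₀ (by positivity), mul_comm]
  exact card_mul_abs_le_sum_powerset hj a

lemma average_rpow_le (s : Finset ℕ) (a : ℕ → ℝ) {p : ℝ} (hp : 1 ≤ p) (hp2 : p < 2) :
    ∑ t ∈ s.powerset, |∑ k ∈ s, signOn t k * a k| ^ p / 2 ^ s.card ≤
      (∑ k ∈ s, a k ^ 2) ^ (p / 2) := by
  have hp0 : 0 < p := by linarith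
  have h := rpow_sum_powerset_le s (q := 2 / p) (by rw [le_div_iff₀ hp0]; linarith)
    (fun t => |∑ k ∈ s, signOn t k * a k| ^ p) (fun t => by positivity)
  have h2 : ∑ t ∈ s.powerset, (|∑ k ∈ s, signOn t k * a k| ^ p) ^ (2 / p) / 2 ^ s.card =
      ∑ k ∈ s, a k ^ 2 := by
    have : ∀ t : Finset ℕ, (|∑ k ∈ s, signOn t k * a k| ^ p) ^ (2 / p) =
        (0 + ∑ k ∈ s, signOn t k * a k) ^ 2 := by
      intro t
      rw [← Real.rpow_mul (abs_nonneg _), mul_div_cancel₀ _ hp0.ne', Real.rpow_two, sq_abs,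
        zero_add]
    simp only [this]
    rw [← Finset.sum_div, sum_powerset_sq]
    field_simp
    ring
  rw [h2] at h
  have h0 : 0 ≤ ∑ t ∈ s.powerset, |∑ k ∈ s, signOn t k * a k| ^ p / 2 ^ s.card :=
    Finset.sum_nonneg fun t _ => by positivity
  have := Real.rpow_le_rpow (by positivity) h (show 0 ≤ p / 2 by linarith)
  rwa [← Real.rpow_mul h0, show 2 / p * (p / 2) = 1 by field_simp, Real.rpow_one] at this

lemma sum_rpow_le_sum_rpow (s : Finset ℕ) (a : ℕ → ℝ) (ha : ∀ k, 0 ≤ a k) {r : ℝ} (hr : 0 < r)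
    (hr1 : r ≤ 1) : (∑ k ∈ s, a k) ^ r ≤ ∑ k ∈ s, a k ^ r := by
  induction s using Finset.induction_on with
  | empty => simp [Real.zero_rpow hr.ne']
  | insert i s hi ih =>
    rw [Finset.sum_insert hi, Finset.sum_insert hi]
    exact (Real.rpow_add_le_add_rpow (ha i) (Finset.sum_nonneg fun k _ => ha k) hr.le hr1).trans
      (by gcongr)

lemma sq_rpow_half (b p : ℝ) : (b ^ 2) ^ (p / 2) = |b| ^ p := by
  rw [← sq_abs, ← Real.rpow_natCast, ← Real.rpow_mul (abs_nonneg b)]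
  congr 1; push_cast; ring

lemma square_function_le_sum (s : Finset ℕ) (a : ℕ → ℝ) {p : ℝ} (hp : 1 ≤ p) (hp2 : p < 2) :
    (∑ k ∈ s, a k ^ 2) ^ (p / 2) ≤ ∑ k ∈ s, |a k| ^ p := by
  refine (sum_rpow_le_sum_rpow s (fun k => a k ^ 2) (fun k => sq_nonneg _)
    (by linarith) (by linarith)).trans (le_of_eq ?_)
  simp only [sq_rpow_half]

lemma square_function_le_truncated (s : Finset ℕ) (a : ℕ → ℝ) {p M : ℝ} (hp : 1 ≤ p) (hp2 : p < 2)
    (hM : 0 ≤ M) :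
    (∑ k ∈ s, a k ^ 2) ^ (p / 2) ≤
      (s.card : ℝ) ^ (p / 2) * M ^ p + ∑ k ∈ s, if M < |a k| then |a k| ^ p else 0 := by
  have h1 : ∑ k ∈ s, a k ^ 2 ≤ s.card * M ^ 2 + ∑ k ∈ s, if M < |a k| then a k ^ 2 else 0 := by
    rw [← nsmul_eq_mul, ← Finset.sum_const, ← Finset.sum_add_distrib]
    refine Finset.sum_le_sum fun k _ => ?_
    split_ifs with h
    · nlinarith
    · rw [add_zero, ← sq_abs]; gcongr; exact not_lt.1 h
  refine (Real.rpow_le_rpow (Finset.sum_nonneg fun k _ => sq_nonneg _) h1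
    (by linarith)).trans ?_
  refine (Real.rpow_add_le_add_rpow (by positivity)
    (Finset.sum_nonneg fun k _ => by positivity) (by linarith) (by linarith)).trans ?_
  rw [Real.mul_rpow (by positivity) (by positivity), sq_rpow_half, abs_of_nonneg hM]
  gcongr
  refine (sum_rpow_le_sum_rpow s (fun k => if M < |a k| then a k ^ 2 else 0)
    (fun k => by positivity) (by linarith) (by linarith)).trans (Finset.sum_le_sum fun k _ => ?_)
  split_ifs
  · rw [sq_rpow_half]
  · rw [Real.zero_rpow (by linarith)]

/-- Disjointification of the sets `A k`, in pointwise form. -/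
lemma sum_indicator_sub_le {Ω : Type*} (A : ℕ → Set Ω) (ω : Ω) (s : Finset ℕ) (b : ℕ → ℝ) {B : ℝ}
    (hb0 : ∀ k, 0 ≤ b k) (hB : 0 ≤ B) (hb : ∀ k ∈ s, b k ≤ B) :
    ∑ k ∈ s, ((A k).indicator (fun _ => b k) ω -
      ∑ l ∈ s with k < l, (A l).indicator (fun _ => b k) ω) ≤ B := by
  have hind : ∀ k l, 0 ≤ (A l).indicator (fun _ => b k) ω := fun k l =>
    Set.indicator_nonneg (fun _ _ => hb0 k) ω
  have hind' : ∀ k l, (A l).indicator (fun _ => b k) ω ≤ b k := fun k l =>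
    Set.indicator_le_self' (fun _ _ => hb0 k) ω
  induction s using Finset.induction_on_max with
  | empty => simpa
  | insert i s hi ih =>
    have his : i ∉ s := fun h => lt_irrefl _ (hi i h)
    rw [Finset.sum_insert his]
    by_cases hA : ω ∈ A i
    · have h1 : ∀ k ∈ s, (A k).indicator (fun _ => b k) ω -
          ∑ l ∈ insert i s with k < l, (A l).indicator (fun _ => b k) ω ≤ 0 := by
        intro k hk
        have := Finset.single_le_sum (s := (insert i s).filter (k < ·))
          (f := fun l => (A l).indicator (fun _ => b k) ω) (fun l _ => hind k l)
          (a := i) (by simp [hi k hk])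
        rw [Set.indicator_of_mem hA] at this
        linarith [hind' k k]
      have h2 := Finset.sum_nonpos h1
      have h3 : 0 ≤ ∑ l ∈ insert i s with i < l, (A l).indicator (fun _ => b i) ω :=
        Finset.sum_nonneg fun l _ => hind i l
      linarith [hind' i i, hb i (Finset.mem_insert_self _ _)]
    · have h1 : ∀ k ∈ s, (A k).indicator (fun _ => b k) ω -
          ∑ l ∈ insert i s with k < l, (A l).indicator (fun _ => b k) ω ≤
          (A k).indicator (fun _ => b k) ω -
          ∑ l ∈ s with k < l, (A l).indicator (fun _ => b k) ω := by
        intro k _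
        refine sub_le_sub_left (Finset.sum_le_sum_of_subset_of_nonneg ?_ fun l _ _ => hind k l) _
        exact Finset.filter_subset_filter _ (Finset.subset_insert _ _)
      have h2 := Finset.sum_le_sum h1
      have h3 : 0 ≤ ∑ l ∈ insert i s with i < l, (A l).indicator (fun _ => b i) ω :=
        Finset.sum_nonneg fun l _ => hind i l
      rw [Set.indicator_of_notMem hA]
      linarith [ih fun k hk => hb k (Finset.mem_insert_of_mem hk)]

section Lp

variable {Ω : Type*} [MeasurableSpace Ω] {μ : Measure Ω} {p : ℝ}

lemma integrable_abs_rpow (hp : 1 ≤ p) (f : Lp ℝ (ENNReal.ofReal p) μ) :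
    Integrable (fun ω => |f ω| ^ p) μ := by
  have h := (Lp.memLp f).integrable_norm_rpow
    (by simpa using (by linarith : 0 < p)) ENNReal.ofReal_ne_top
  simpa [ENNReal.toReal_ofReal (by linarith : 0 ≤ p)] using h

lemma norm_rpow_eq_integral (hp : 1 ≤ p) (f : Lp ℝ (ENNReal.ofReal p) μ) :
    ‖f‖ ^ p = ∫ ω, |f ω| ^ p ∂μ := by
  have hp0 : 0 < p := by linarith
  have h0 : 0 ≤ ∫ ω, |f ω| ^ p ∂μ := integral_nonneg fun ω => by positivity
  rw [Lp.norm_def, (Lp.memLp f).eLpNorm_eq_integral_rpow_norm (by simpa using hp0)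
    ENNReal.ofReal_ne_top, ENNReal.toReal_ofReal hp0.le]
  simp only [Real.norm_eq_abs]
  rw [ENNReal.toReal_ofReal (by positivity), ← Real.rpow_mul h0, inv_mul_cancel₀ hp0.ne',
    Real.rpow_one]

lemma coeFn_sum_smul (s : Finset ℕ) (c : ℕ → ℝ) (f : ℕ → Lp ℝ (ENNReal.ofReal p) μ) :
    ⇑(∑ k ∈ s, c k • f k) =ᵐ[μ] fun ω => ∑ k ∈ s, c k * f k ω := by
  have h : ∀ᵐ ω ∂μ, ∀ k : ℕ, (c k • f k : Lp ℝ (ENNReal.ofReal p) μ) ω = c k * f k ω :=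
    ae_all_iff.2 fun k => Lp.coeFn_smul (c k) (f k)
  filter_upwards [Lp.coeFn_fun_finsetSum s fun k => c k • f k, h] with ω h1 h2
  rw [h1]
  exact Finset.sum_congr rfl fun k _ => h2 k

lemma integrable_abs_sum_rpow (hp : 1 ≤ p) (s : Finset ℕ) (c : ℕ → ℝ)
    (f : ℕ → Lp ℝ (ENNReal.ofReal p) μ) :
    Integrable (fun ω => |∑ k ∈ s, c k * f k ω| ^ p) μ := by
  refine (integrable_abs_rpow hp (∑ k ∈ s, c k • f k)).congr ?_
  filter_upwards [coeFn_sum_smul s c f] with ω h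
  rw [h]

lemma norm_sum_rpow_eq_integral (hp : 1 ≤ p) (s : Finset ℕ) (c : ℕ → ℝ)
    (f : ℕ → Lp ℝ (ENNReal.ofReal p) μ) :
    ‖∑ k ∈ s, c k • f k‖ ^ p = ∫ ω, |∑ k ∈ s, c k * f k ω| ^ p ∂μ := by
  rw [norm_rpow_eq_integral hp]
  refine integral_congr_ae ?_
  filter_upwards [coeFn_sum_smul s c f] with ω h
  rw [h]

/-- The average over all signs of the `p`-th powers of the absolute values of the signed sums. -/
def signAverage (p : ℝ) (s : Finset ℕ) (b : ℕ → ℝ) : ℝ :=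
  ∑ t ∈ s.powerset, |∑ k ∈ s, signOn t k * b k| ^ p / 2 ^ s.card

lemma integrable_signAverage (hp : 1 ≤ p) (s : Finset ℕ) (a : ℕ → ℝ)
    (f : ℕ → Lp ℝ (ENNReal.ofReal p) μ) :
    Integrable (fun ω => signAverage p s fun k => a k * f k ω) μ := by
  unfold signAverage
  refine integrable_finsetSum _ fun t _ => Integrable.div_const ?_ _
  simpa only [mul_assoc] using integrable_abs_sum_rpow hp s (fun k => signOn t k * a k) f

lemma integral_signAverage (hp : 1 ≤ p) (s : Finset ℕ) (a : ℕ → ℝ)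
    (f : ℕ → Lp ℝ (ENNReal.ofReal p) μ) :
    ∫ ω, signAverage p s (fun k => a k * f k ω) ∂μ =
      ∑ t ∈ s.powerset, ‖∑ k ∈ s, (signOn t k * a k) • f k‖ ^ p / 2 ^ s.card := by
  unfold signAverage
  rw [integral_finsetSum]
  · refine Finset.sum_congr rfl fun t _ => ?_
    rw [norm_sum_rpow_eq_integral hp, integral_div]
    simp only [mul_assoc]
  · refine fun t _ => Integrable.div_const ?_ _
    simpa only [mul_assoc] using integrable_abs_sum_rpow hp s (fun k => signOn t k * a k) f

lemma sum_powerset_const (s : Finset ℕ) (C : ℝ) :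
    ∑ _t ∈ s.powerset, C / 2 ^ s.card = C := by
  rw [Finset.sum_const, Finset.card_powerset, nsmul_eq_mul]; push_cast; field_simp

/-- The integral of `|f|^p` over any set of measure at most `d` is at most `ε`. -/
def SmallOnSmallSets (f : Lp ℝ (ENNReal.ofReal p) μ) (ε d : ℝ) : Prop :=
  ∀ A : Set Ω, MeasurableSet A → μ A ≤ ENNReal.ofReal d → ∫ ω in A, |f ω| ^ p ∂μ ≤ ε

lemma SmallOnSmallSets.mono {f : Lp ℝ (ENNReal.ofReal p) μ} {ε ε' d d' : ℝ}
    (h : SmallOnSmallSets f ε d) (hε : ε ≤ ε') (hd : d' ≤ d) : SmallOnSmallSets f ε' d' :=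
  fun A hA hμA => (h A hA (hμA.trans (ENNReal.ofReal_le_ofReal hd))).trans hε

lemma exists_smallOnSmallSets (hp : 1 ≤ p) (f : Lp ℝ (ENNReal.ofReal p) μ) {ε : ℝ} (hε : 0 < ε) :
    ∃ d, 0 < d ∧ SmallOnSmallSets f ε d := by
  have h := (integrable_abs_rpow hp f).tendsto_setIntegral_nhds_zero
    (l := comap μ (nhds 0)) (s := fun A : Set Ω => A) tendsto_comap
  have h2 := h.eventually (gt_mem_nhds hε)
  rw [eventually_comap, ENNReal.nhds_zero_basis_Iic.eventually_iff] at h2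
  obtain ⟨c, hc, h2⟩ := h2
  obtain ⟨d, hd, hdc⟩ := ENNReal.lt_iff_exists_nnreal_btwn.1 hc
  refine ⟨d, by exact_mod_cast hd, fun A _ hμA => (h2 (x := μ A) ?_ A rfl).le⟩
  rw [ENNReal.ofReal_coe_nnreal] at hμA
  exact hμA.trans hdc.le

/-- The equivalence constant obtained from the upper and lower `p`-estimates. -/
def lqConstant (u K p η : ℝ) : ℝ := 1 + u * K + u * (2 / η) ^ (1 / p)

lemma one_le_lqConstant {u K η : ℝ} (hu : 1 ≤ u) (hK : 0 ≤ K) (hη : 0 < η) :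
    1 ≤ lqConstant u K p η := by
  have : 0 ≤ u * (2 / η) ^ (1 / p) := by positivity
  have : 0 ≤ u * K := by positivity
  unfold lqConstant
  linarith

variable [Fact (1 ≤ ENNReal.ofReal p)]

lemma IsUnconditionalWith.norm_rpow_le_average {u : ℝ} {f : ℕ → Lp ℝ (ENNReal.ofReal p) μ}
    (hf : IsUnconditionalWith u f) (hu : 1 ≤ u) (hp : 1 ≤ p) (s : Finset ℕ) (a : ℕ → ℝ) :
    ‖∑ k ∈ s, a k • f k‖ ^ p ≤ u ^ p * ∫ ω, signAverage p s (fun k => a k * f k ω) ∂μ := by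
  rw [integral_signAverage hp, Finset.mul_sum, ← sum_powerset_const s (‖_‖ ^ p)]
  refine Finset.sum_le_sum fun t _ => ?_
  rw [← mul_div_assoc]
  gcongr
  rw [← Real.mul_rpow (by linarith) (norm_nonneg _)]
  refine Real.rpow_le_rpow (norm_nonneg _) ?_ (by linarith)
  have h := hf s (fun k => signOn t k * a k) (signOn t) fun k _ => abs_signOn t k
  simpa only [← mul_assoc, signOn_mul_self, one_mul] using h

lemma IsUnconditionalWith.average_le_norm_rpow {u : ℝ} {f : ℕ → Lp ℝ (ENNReal.ofReal p) μ}
    (hf : IsUnconditionalWith u f) (hu : 1 ≤ u) (hp : 1 ≤ p) (s : Finset ℕ) (a : ℕ → ℝ) :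
    ∫ ω, signAverage p s (fun k => a k * f k ω) ∂μ ≤ u ^ p * ‖∑ k ∈ s, a k • f k‖ ^ p := by
  rw [integral_signAverage hp, ← sum_powerset_const s (u ^ p * ‖_‖ ^ p)]
  refine Finset.sum_le_sum fun t _ => ?_
  gcongr
  rw [← Real.mul_rpow (by linarith) (norm_nonneg _)]
  exact Real.rpow_le_rpow (norm_nonneg _) (hf s a (signOn t) fun k _ => abs_signOn t k)
    (by linarith)

/-- Unconditional sequences in `L^p`, `1 ≤ p < 2`, satisfy an upper `p`-estimate. -/
lemma IsUnconditionalWith.norm_rpow_le {u : ℝ} {f : ℕ → Lp ℝ (ENNReal.ofReal p) μ}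
    (hf : IsUnconditionalWith u f) (hu : 1 ≤ u) (hp : 1 ≤ p) (hp2 : p < 2) (s : Finset ℕ)
    (a : ℕ → ℝ) {K : ℝ} (hK : ∀ k ∈ s, ‖f k‖ ≤ K) :
    ‖∑ k ∈ s, a k • f k‖ ^ p ≤ u ^ p * (K ^ p * ∑ k ∈ s, |a k| ^ p) := by
  refine (hf.norm_rpow_le_average hu hp s a).trans ?_
  gcongr
  have hint : ∀ k ∈ s, Integrable (fun ω => |a k * f k ω| ^ p) μ := fun k _ => by
    simp only [abs_mul, Real.mul_rpow (abs_nonneg _) (abs_nonneg _)]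
    exact (integrable_abs_rpow hp (f k)).const_mul _
  calc ∫ ω, signAverage p s (fun k => a k * f k ω) ∂μ
      ≤ ∫ ω, ∑ k ∈ s, |a k * f k ω| ^ p ∂μ :=
        integral_mono (integrable_signAverage hp s a f) (integrable_finsetSum _ hint) fun ω =>
          (average_rpow_le s _ hp hp2).trans (square_function_le_sum s _ hp hp2)
    _ = ∑ k ∈ s, |a k| ^ p * ‖f k‖ ^ p := by
        rw [integral_finsetSum _ hint]
        refine Finset.sum_congr rfl fun k _ => ?_
        simp only [abs_mul, Real.mul_rpow (abs_nonneg _) (abs_nonneg _)]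
        rw [integral_const_mul, norm_rpow_eq_integral hp]
    _ ≤ K ^ p * ∑ k ∈ s, |a k| ^ p := by
        rw [Finset.mul_sum]
        refine Finset.sum_le_sum fun k hk => ?_
        rw [mul_comm]
        gcongr
        exact hK k hk

lemma IsUnconditionalWith.norm_rpow_le_truncated {u : ℝ} {f : ℕ → Lp ℝ (ENNReal.ofReal p) μ}
    [IsProbabilityMeasure μ]
    (hf : IsUnconditionalWith u f) (hu : 1 ≤ u) (hp : 1 ≤ p) (hp2 : p < 2) (s : Finset ℕ)
    {M : ℝ} (hM : 0 ≤ M) :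
    ‖∑ k ∈ s, f k‖ ^ p ≤ u ^ p * ((s.card : ℝ) ^ (p / 2) * M ^ p +
      ∑ k ∈ s, ∫ ω in {ω | M < |f k ω|}, |f k ω| ^ p ∂μ) := by
  have h := hf.norm_rpow_le_average hu hp s fun _ => 1
  simp only [one_smul, one_mul] at h
  refine h.trans ?_
  gcongr
  have hmeas : ∀ k, MeasurableSet {ω | M < |f k ω|} := fun k =>
    measurableSet_lt measurable_const (Lp.stronglyMeasurable (f k)).measurable.abs
  have hint : ∀ k ∈ s, Integrable ({ω | M < |f k ω|}.indicator fun ω => |f k ω| ^ p) μ :=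
    fun k _ => (integrable_abs_rpow hp (f k)).indicator (hmeas k)
  calc ∫ ω, signAverage p s (fun k => f k ω) ∂μ
      ≤ ∫ ω, ((s.card : ℝ) ^ (p / 2) * M ^ p +
          ∑ k ∈ s, {ω | M < |f k ω|}.indicator (fun ω => |f k ω| ^ p) ω) ∂μ := by
        refine integral_mono ?_ ((integrable_const _).add (integrable_finsetSum _ hint))
          fun ω => (average_rpow_le s _ hp hp2).trans ?_
        · simpa only [one_mul] using integrable_signAverage hp s (fun _ => 1) f
        · exact square_function_le_truncated s _ hp hp2 hM
    _ = _ := by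
        rw [integral_add (integrable_const _) (integrable_finsetSum _ hint),
          integral_finsetSum _ hint]
        simp [integral_indicator (hmeas _)]

lemma sum_geometric_filter_le (s : Finset ℕ) (k : ℕ) {η : ℝ} (hη : 0 ≤ η) :
    ∑ l ∈ s with k < l, η / 4 * (1 / 2) ^ l ≤ η / 2 := by
  rw [← Finset.mul_sum]
  have := (summable_geometric_two).sum_le_tsum (s.filter (k < ·)) fun i _ => by positivity
  rw [tsum_geometric_two] at this
  nlinarith

/-- Unconditional sequences in `L^p` with almost disjoint big parts satisfy a lower
`p`-estimate. -/
lemma IsUnconditionalWith.le_norm_rpow {u : ℝ} {f : ℕ → Lp ℝ (ENNReal.ofReal p) μ}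
    (hf : IsUnconditionalWith u f) (hu : 1 ≤ u) (hp : 1 ≤ p) (s : Finset ℕ)
    (a : ℕ → ℝ) {η : ℝ} (hη : 0 ≤ η) (A : ℕ → Set Ω) (hA : ∀ k ∈ s, MeasurableSet (A k))
    (hbig : ∀ k ∈ s, η ≤ ∫ ω in A k, |f k ω| ^ p ∂μ)
    (hsmall : ∀ k ∈ s, ∀ l ∈ s, k < l → ∫ ω in A l, |f k ω| ^ p ∂μ ≤ η / 4 * (1 / 2) ^ l) :
    η / 2 * ∑ k ∈ s, |a k| ^ p ≤ u ^ p * ‖∑ k ∈ s, a k • f k‖ ^ p := by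
  refine le_trans ?_ (hf.average_le_norm_rpow hu hp s a)
  have heq : ∀ k ω, |a k * f k ω| ^ p = |a k| ^ p * |f k ω| ^ p := fun k ω => by
    rw [abs_mul, Real.mul_rpow (abs_nonneg _) (abs_nonneg _)]
  have hint : ∀ k, ∀ l ∈ s, Integrable ((A l).indicator fun ω => |a k * f k ω| ^ p) μ :=
    fun k l hl => by
      simp only [heq]
      exact ((integrable_abs_rpow hp (f k)).const_mul _).indicator (hA l hl)
  have hval : ∀ k, ∀ l ∈ s, ∫ ω, (A l).indicator (fun ω => |a k * f k ω| ^ p) ω ∂μ =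
      |a k| ^ p * ∫ ω in A l, |f k ω| ^ p ∂μ := fun k l hl => by
    rw [integral_indicator (hA l hl)]
    simp only [heq]
    rw [integral_const_mul]
  have hint2 : ∀ k, Integrable (fun ω => ∑ l ∈ s with k < l,
      (A l).indicator (fun ω => |a k * f k ω| ^ p) ω) μ := fun k =>
    integrable_finsetSum _ fun l hl => hint k l (Finset.mem_filter.1 hl).1
  have hint3 : ∀ k ∈ s, Integrable (fun ω => (A k).indicator (fun ω => |a k * f k ω| ^ p) ω -
      ∑ l ∈ s with k < l, (A l).indicator (fun ω => |a k * f k ω| ^ p) ω) μ := fun k hk =>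
    (hint k k hk).sub (hint2 k)
  calc η / 2 * ∑ k ∈ s, |a k| ^ p
      ≤ ∑ k ∈ s, ∫ ω, ((A k).indicator (fun ω => |a k * f k ω| ^ p) ω -
          ∑ l ∈ s with k < l, (A l).indicator (fun ω => |a k * f k ω| ^ p) ω) ∂μ := by
        rw [Finset.mul_sum]
        refine Finset.sum_le_sum fun k hk => ?_
        rw [integral_sub (hint k k hk) (hint2 k), integral_finsetSum _ fun l hl =>
          hint k l (Finset.mem_filter.1 hl).1, hval k k hk, Finset.sum_congr rfl fun l hl =>
          hval k l (Finset.mem_filter.1 hl).1, ← Finset.mul_sum, ← mul_sub, mul_comm]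
        gcongr
        have h1 : ∑ l ∈ s with k < l, ∫ ω in A l, |f k ω| ^ p ∂μ ≤
            ∑ l ∈ s with k < l, η / 4 * (1 / 2) ^ l := Finset.sum_le_sum fun l hl =>
          hsmall k hk l (Finset.mem_filter.1 hl).1 (Finset.mem_filter.1 hl).2
        linarith [hbig k hk, sum_geometric_filter_le s k hη]
    _ = ∫ ω, ∑ k ∈ s, ((A k).indicator (fun ω => |a k * f k ω| ^ p) ω -
          ∑ l ∈ s with k < l, (A l).indicator (fun ω => |a k * f k ω| ^ p) ω) ∂μ :=
        (integral_finsetSum _ hint3).symm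
    _ ≤ ∫ ω, signAverage p s (fun k => a k * f k ω) ∂μ := by
        refine integral_mono (integrable_finsetSum _ hint3) (integrable_signAverage hp s a f)
          fun ω => ?_
        exact le_trans (le_of_eq rfl) (sum_indicator_sub_le A ω s (fun k => |a k * f k ω| ^ p)
          (fun k => by positivity) (Finset.sum_nonneg fun t _ => by positivity)
          fun k hk => rpow_abs_le_average hk (fun k => a k * f k ω) hp)

lemma SmallOnSmallSets.exists_tail [IsProbabilityMeasure μ] (hp : 1 ≤ p) {K d : ℝ}
    (hd : 0 < d) :
    ∃ M, 0 < M ∧ ∀ f : Lp ℝ (ENNReal.ofReal p) μ, ‖f‖ ≤ K → ∀ ε, SmallOnSmallSets f ε d →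
      ∫ ω in {ω | M < |f ω|}, |f ω| ^ p ∂μ ≤ ε := by
  have hp0 : 0 < p := by linarith
  set Q : ℝ := |K| ^ p / d + 1 with hQ
  have hQ0 : 0 < Q := by positivity
  refine ⟨Q ^ (1 / p), by positivity, fun f hf ε h => h _
    (measurableSet_lt measurable_const (Lp.stronglyMeasurable f).measurable.abs) ?_⟩
  have hmarkov := mul_meas_ge_le_integral_of_nonneg (ae_of_all μ fun ω => by positivity)
    (integrable_abs_rpow hp f) Q
  rw [← norm_rpow_eq_integral hp] at hmarkov
  have hfK : ‖f‖ ^ p ≤ |K| ^ p :=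
    Real.rpow_le_rpow (norm_nonneg _) (hf.trans (le_abs_self K)) hp0.le
  have hKQ : |K| ^ p ≤ Q * d := by rw [hQ, add_mul, div_mul_cancel₀ _ hd.ne']; linarith
  have hreal : μ.real {ω | Q ≤ |f ω| ^ p} ≤ d :=
    le_of_mul_le_mul_left (hmarkov.trans (hfK.trans hKQ)) hQ0
  have hsub : {ω | Q ^ (1 / p) < |f ω|} ⊆ {ω | Q ≤ |f ω| ^ p} := by
    intro ω hω
    have := Real.rpow_le_rpow (by positivity) (le_of_lt hω) hp0.le
    rwa [← Real.rpow_mul hQ0.le, one_div, inv_mul_cancel₀ hp0.ne', Real.rpow_one] at this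
  refine (measure_mono hsub).trans ?_
  rw [ENNReal.le_ofReal_iff_toReal_le (measure_ne_top _ _) hd.le]
  exact hreal

lemma IsUnconditionalWith.comp {E : Type*} [NormedAddCommGroup E] [NormedSpace ℝ E] {u : ℝ}
    {f : ℕ → E} (hf : IsUnconditionalWith u f) {k : ℕ → ℕ} (hk : StrictMono k) :
    IsUnconditionalWith u fun m => f (k m) := by
  intro s c e he
  have hinv : ∀ m, Function.invFun k (k m) = m := Function.leftInverse_invFun hk.injective
  have h := hf (s.map ⟨k, hk.injective⟩) (fun m => c (Function.invFun k m))
    (fun m => e (Function.invFun k m)) (by simpa [hinv] using he)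
  simpa [hinv] using h

/-- A greedy selection of indices `j k` and thresholds `d k`, where each threshold is small in
terms of the previously chosen indices. -/
lemma exists_greedy_selection (P : ℝ → ℕ → Prop) (Q : ℕ → ℝ → ℝ → Prop)
    (hP : ∀ d, 0 < d → ∀ N, ∃ j > N, P d j)
    (hQ : ∀ j ε, 0 < ε → ∃ d, 0 < d ∧ Q j ε d)
    (hmono : ∀ j ε ε' d d', Q j ε d → ε ≤ ε' → d' ≤ d → Q j ε' d') {η : ℝ} (hη : 0 < η) :
    ∃ (j : ℕ → ℕ) (d : ℕ → ℝ), StrictMono j ∧ (∀ k, P (d k) (j k)) ∧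
      ∀ k l, k < l → Q (j k) (η / 4 * (1 / 2) ^ l) (d l) := by
  obtain ⟨F, hF, hr⟩ := exists_seq_of_forall_finset_exists
    (fun y : ℕ × ℝ × ℕ => P y.2.1 y.1)
    (fun y z => y.1 < z.1 ∧ y.2.2 < z.2.2 ∧ Q y.1 (η / 4 * (1 / 2) ^ z.2.2) z.2.1) (by
      intro s hs
      obtain ⟨n, hn⟩ : ∃ n, ∀ y ∈ s, y.2.2 < n :=
        ⟨s.sup (fun y => y.2.2) + 1, fun y hy =>
          Nat.lt_succ_of_le (Finset.le_sup (f := fun y : ℕ × ℝ × ℕ => y.2.2) hy)⟩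
      obtain ⟨d, hd, hdQ⟩ : ∃ d, 0 < d ∧ ∀ y ∈ s, Q y.1 (η / 4 * (1 / 2) ^ n) d := by
        clear hn hs
        induction s using Finset.induction_on with
        | empty => exact ⟨1, one_pos, by simp⟩
        | insert y s _ ih =>
          obtain ⟨d, hd, hdQ⟩ := ih
          obtain ⟨d', hd', hdQ'⟩ := hQ y.1 (η / 4 * (1 / 2) ^ n) (by positivity)
          refine ⟨min d d', lt_min hd hd', fun z hz => ?_⟩
          rcases Finset.mem_insert.1 hz with rfl | hz
          · exact hmono _ _ _ _ _ hdQ' le_rfl (min_le_right _ _)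
          · exact hmono _ _ _ _ _ (hdQ z hz) le_rfl (min_le_left _ _)
      obtain ⟨j, hj, hjP⟩ := hP d hd (s.sup fun y => y.1)
      exact ⟨(j, d, n), hjP, fun y hy =>
        ⟨lt_of_le_of_lt (Finset.le_sup (f := fun y : ℕ × ℝ × ℕ => y.1) hy) hj, hn y hy,
          hdQ y hy⟩⟩)
  have hstage : StrictMono fun k => (F k).2.2 := fun k l hkl => (hr k l hkl).2.1
  refine ⟨fun k => (F k).1, fun k => (F k).2.1, fun k l hkl => (hr k l hkl).1, hF,
    fun k l hkl => hmono _ _ _ _ _ (hr k l hkl).2.2 ?_ le_rfl⟩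
  gcongr _ * ?_
  exact pow_le_pow_of_le_one (by norm_num) (by norm_num) (hstage.le_apply (x := l))

lemma IsUnconditionalWith.lq_estimates {u : ℝ} {f : ℕ → Lp ℝ (ENNReal.ofReal p) μ}
    (hf : IsUnconditionalWith u f) (hu : 1 ≤ u) (hp : 1 ≤ p) (hp2 : p < 2) {K η : ℝ}
    (hK0 : 0 ≤ K) (hη : 0 < η) (hK : ∀ k, ‖f k‖ ≤ K) (d : ℕ → ℝ) (s : Finset ℕ)
    (hbig : ∀ k ∈ s, ¬ SmallOnSmallSets (f k) η (d k))
    (hsmall : ∀ k l, k < l → SmallOnSmallSets (f k) (η / 4 * (1 / 2) ^ l) (d l)) (a : ℕ → ℝ) :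
    (1 / lqConstant u K p η) * (∑ k ∈ s, |a k| ^ p) ^ (1 / p) ≤ ‖∑ k ∈ s, a k • f k‖ ∧
      ‖∑ k ∈ s, a k • f k‖ ≤ lqConstant u K p η * (∑ k ∈ s, |a k| ^ p) ^ (1 / p) := by
  have hp0 : 0 < p := by linarith
  have hu0 : 0 < u := by linarith
  have hS : 0 ≤ ∑ k ∈ s, |a k| ^ p := Finset.sum_nonneg fun k _ => by positivity
  have hC1 := one_le_lqConstant (p := p) hu hK0 hη
  have h2 : 0 ≤ u * (2 / η) ^ (1 / p) := by positivity
  have h3 : 0 ≤ u * K := by positivity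
  have hroot : ∀ b : ℝ, 0 ≤ b → (b ^ p) ^ (1 / p) = b := fun b hb => by
    rw [← Real.rpow_mul hb, mul_one_div_cancel hp0.ne', Real.rpow_one]
  constructor
  · have hA : ∀ k, ∃ A : Set Ω, k ∈ s → MeasurableSet A ∧ μ A ≤ ENNReal.ofReal (d k) ∧
        η < ∫ ω in A, |f k ω| ^ p ∂μ := by
      intro k
      by_cases hk : k ∈ s
      · have := hbig k hk
        unfold SmallOnSmallSets at this
        push Not at this
        obtain ⟨A, hA⟩ := this
        exact ⟨A, fun _ => hA⟩
      · exact ⟨∅, fun h => absurd h hk⟩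
    choose A hA using hA
    have h := hf.le_norm_rpow hu hp s a hη.le A (fun k hk => (hA k hk).1)
      (fun k hk => (hA k hk).2.2.le)
      (fun k _ l hl hkl => hsmall k l hkl (A l) (hA l hl).1 (hA l hl).2.1)
    have h' : ∑ k ∈ s, |a k| ^ p ≤ (2 / η) * (u ^ p * ‖∑ k ∈ s, a k • f k‖ ^ p) := by
      rw [div_mul_eq_mul_div, le_div_iff₀ hη]; linarith
    have h'' := Real.rpow_le_rpow hS h' (show 0 ≤ 1 / p by positivity)
    rw [Real.mul_rpow (by positivity) (by positivity),
      Real.mul_rpow (by positivity) (by positivity), hroot _ hu0.le,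
      hroot _ (norm_nonneg _)] at h''
    rw [one_div_mul_eq_div, div_le_iff₀ (by linarith)]
    calc _ ≤ _ := h''
      _ = (u * (2 / η) ^ (1 / p)) * ‖∑ k ∈ s, a k • f k‖ := by ring
      _ ≤ lqConstant u K p η * ‖∑ k ∈ s, a k • f k‖ := by
        gcongr; unfold lqConstant; linarith
      _ = _ := mul_comm _ _
  · have h := hf.norm_rpow_le hu hp hp2 s a fun k _ => hK k
    have h' := Real.rpow_le_rpow (by positivity) h (show 0 ≤ 1 / p by positivity)
    rw [Real.mul_rpow (by positivity) (by positivity), Real.mul_rpow (by positivity) hS,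
      hroot _ hu0.le, hroot _ hK0, hroot _ (norm_nonneg _), ← mul_assoc] at h'
    refine h'.trans ?_
    gcongr
    unfold lqConstant; linarith

/-- A sequence in `L^p` that fails uniform integrability has a subsequence equivalent to the
`ℓ^p` basis, if it is bounded and unconditional. -/
lemma exists_subsequence_isLqBasisEquiv {f : ℕ → Lp ℝ (ENNReal.ofReal p) μ}
    (hf : IsUnconditional f) (hp : 1 ≤ p) (hp2 : p < 2) {K η : ℝ} (hK0 : 0 ≤ K) (hη : 0 < η)
    (hK : ∀ k, ‖f k‖ ≤ K) (hbad : ∀ d, 0 < d → ∃ i, ¬ SmallOnSmallSets (f i) η d) :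
    ∃ k : ℕ → ℕ, StrictMono k ∧ ∃ K', 1 ≤ K' ∧ IsLqBasisEquiv p K' fun m => f (k m) := by
  obtain ⟨u, hu, hf⟩ := hf
  obtain ⟨k, d, hk, hbig, hsmall⟩ := exists_greedy_selection
    (fun d j => ¬ SmallOnSmallSets (f j) η d) (fun j ε d => SmallOnSmallSets (f j) ε d) (by
      intro d hd N
      obtain ⟨d', hd', hN⟩ : ∃ d' > 0, ∀ i < N + 1, SmallOnSmallSets (f i) η d' := by
        generalize N + 1 = n
        induction n with
        | zero => exact ⟨1, one_pos, by simp⟩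
        | succ n ih =>
          obtain ⟨d₁, hd₁, h₁⟩ := ih
          obtain ⟨d₂, hd₂, h₂⟩ := exists_smallOnSmallSets hp (f n) hη
          refine ⟨min d₁ d₂, lt_min hd₁ hd₂, fun i hi => ?_⟩
          rcases Nat.lt_succ_iff_lt_or_eq.1 hi with hi | rfl
          · exact (h₁ i hi).mono le_rfl (min_le_left _ _)
          · exact h₂.mono le_rfl (min_le_right _ _)
      obtain ⟨i, hi⟩ := hbad (min d d') (lt_min hd hd')
      refine ⟨i, ?_, fun h => hi (h.mono le_rfl (min_le_left _ _))⟩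
      by_contra hiN
      exact hi ((hN i (by omega)).mono le_rfl (min_le_right _ _)))
    (fun j ε hε => exists_smallOnSmallSets hp (f j) hε)
    (fun j ε ε' d d' h hε hd => h.mono hε hd) hη
  exact ⟨k, hk, _, one_le_lqConstant (p := p) hu hK0 hη, fun s a =>
    (hf.comp hk).lq_estimates hu hp hp2 hK0 hη (fun m => hK _) d s (fun m _ => hbig m) hsmall a⟩

/-- An unconditional sequence in `L^p` that is bounded and asymptotically uniformly integrable
has partial sums of order `o(n ^ (1 / p))`. -/
lemma tendsto_norm_sum_of_smallOnSmallSets [IsProbabilityMeasure μ]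
    {f : ℕ → Lp ℝ (ENNReal.ofReal p) μ}
    (hf : IsUnconditional f) (hp : 1 ≤ p) (hp2 : p < 2) {K : ℝ} (hK0 : 0 ≤ K)
    (hK : ∀ k, ‖f k‖ ≤ K)
    (hsmall : ∀ ε, 0 < ε → ∃ m d, 0 < d ∧ ∀ l : ℕ, m ≤ l → SmallOnSmallSets (f l) ε d) :
    Tendsto (fun n : ℕ => (n : ℝ) ^ (-(1 / p)) * ‖∑ m ∈ Finset.range n, f m‖) atTop (nhds 0) := by
  have hp0 : 0 < p := by linarith
  obtain ⟨u, hu, hf⟩ := hf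
  have hbound : ∀ ε, 0 < ε → ∃ M : ℝ, ∃ m : ℕ, 0 < M ∧ ∀ n : ℕ,
      ‖∑ l ∈ Finset.range n, f l‖ ^ p ≤
        u ^ p * ((n : ℝ) ^ (p / 2) * M ^ p + (m * K ^ p + n * ε)) := by
    intro ε hε
    obtain ⟨m, d, hd, hm⟩ := hsmall ε hε
    obtain ⟨M, hM, htail⟩ := SmallOnSmallSets.exists_tail (μ := μ) hp (K := K) hd
    refine ⟨M, m, hM, fun n => (hf.norm_rpow_le_truncated hu hp hp2 _ hM.le).trans ?_⟩
    rw [Finset.card_range]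
    gcongr
    have hterm : ∀ l, ∫ ω in {ω | M < |f l ω|}, |f l ω| ^ p ∂μ ≤
        (if l < m then K ^ p else 0) + ε := by
      intro l
      split_ifs with hl
      · refine (setIntegral_le_integral (integrable_abs_rpow hp (f l))
          (ae_of_all _ fun ω => by positivity)).trans ?_
        rw [← norm_rpow_eq_integral hp]
        have := Real.rpow_le_rpow (norm_nonneg _) (hK l) hp0.le
        linarith
      · rw [zero_add]
        exact htail (f l) (hK l) ε (hm l (not_lt.1 hl))
    refine (Finset.sum_le_sum fun l _ => hterm l).trans ?_
    rw [Finset.sum_add_distrib, Finset.sum_const, Finset.card_range, nsmul_eq_mul,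
      ← Finset.sum_filter, Finset.sum_const, nsmul_eq_mul]
    gcongr
    calc ((Finset.range n).filter (· < m)).card ≤ (Finset.range m).card :=
          Finset.card_le_card fun l hl => by simp at hl ⊢; exact hl.2
      _ = m := Finset.card_range m
  have hpow : Tendsto (fun n : ℕ => (n : ℝ)⁻¹ * ‖∑ m ∈ Finset.range n, f m‖ ^ p)
      atTop (nhds 0) := by
    rw [Metric.tendsto_atTop']
    intro ε hε
    set ε' : ℝ := ε / (2 * u ^ p) with hε'
    obtain ⟨M, m, hM, hb⟩ := hbound ε' (by positivity)
    have hlim : Tendsto (fun n : ℕ => u ^ p * (((n : ℝ) ^ (-(1 - p / 2))) * M ^ p +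
        ((m * K ^ p) * (n : ℝ)⁻¹ + ε'))) atTop
        (nhds (u ^ p * (0 * M ^ p + ((m * K ^ p) * 0 + ε')))) := by
      refine Tendsto.const_mul _ (Tendsto.add (Tendsto.mul_const _ ?_)
        (Tendsto.add_const _ (Tendsto.const_mul _ tendsto_inv_atTop_nhds_zero_nat)))
      exact (tendsto_rpow_neg_atTop (by linarith)).comp tendsto_natCast_atTop_atTop
    have hval : u ^ p * (0 * M ^ p + ((m * K ^ p) * 0 + ε')) < ε := by
      have hu0 : 0 < u ^ p := by positivity
      have : u ^ p * ε' = ε / 2 := by rw [hε']; field_simp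
      rw [zero_mul, mul_zero, zero_add, zero_add, this]
      linarith
    obtain ⟨N, hN⟩ := eventually_atTop.1 (hlim.eventually (gt_mem_nhds hval))
    refine ⟨N, fun n hn => ?_⟩
    have hn0 : (0 : ℝ) < n := by exact_mod_cast (by omega : 0 < n)
    rw [Real.dist_eq, sub_zero, abs_of_nonneg (by positivity)]
    refine lt_of_le_of_lt ?_ (hN n hn.le)
    calc (n : ℝ)⁻¹ * ‖∑ m ∈ Finset.range n, f m‖ ^ p
        ≤ (n : ℝ)⁻¹ * (u ^ p * ((n : ℝ) ^ (p / 2) * M ^ p + (m * K ^ p + n * ε'))) := by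
          gcongr; exact hb n
      _ = _ := by
          rw [show -(1 - p / 2) = p / 2 - 1 by ring, Real.rpow_sub_one hn0.ne']
          field_simp
  have h := hpow.rpow_const (p := 1 / p) (Or.inr (by positivity))
  rw [Real.zero_rpow (by positivity)] at h
  refine h.congr fun n => ?_
  rw [Real.mul_rpow (by positivity) (by positivity), ← Real.rpow_mul (norm_nonneg _),
    mul_one_div_cancel hp0.ne', Real.rpow_one, Real.inv_rpow (by positivity),
    Real.rpow_neg (by positivity)]

end Lp

/-- (Commutative case of the trichotomy Theorem 4.1.) -/
theorem statement8
    {Ω : Type*} [MeasurableSpace Ω] (μ : Measure Ω) [IsProbabilityMeasure μ]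
    (hμ : Atomless μ)
    (p : ℝ) (hp1 : 1 ≤ p) (hp2 : p < 2)
    [Fact (1 ≤ ENNReal.ofReal p)]
    (x : ℕ → ℕ → Lp ℝ (ENNReal.ofReal p) μ)
    (δ K : ℝ) (hδ : 0 < δ) (hδK : δ ≤ K)
    (hnorm : ∀ i j, δ ≤ ‖x i j‖ ∧ ‖x i j‖ ≤ K)
    (hcol : ∀ j, IsUnconditional fun i => x i j)
    (hdiag : ∀ i j : ℕ → ℕ, StrictMono i → StrictMono j →
      IsUnconditional fun k => x (i k) (j k))
    (u : ℝ) (hu : 1 ≤ u)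
    (hrow : ∀ i, IsUnconditionalWith u fun j => x i j) :
    (∃ j, ∃ k : ℕ → ℕ, StrictMono k ∧
        ∃ K' : ℝ, 1 ≤ K' ∧ IsLqBasisEquiv p K' fun m => x (k m) j) ∨
    (∃ C : ℝ, 1 ≤ C ∧ ∀ n : ℕ, ∃ i, ∃ j : Fin n → ℕ, StrictMono j ∧
        IsLqBasisEquivFin p C fun m => x i (j m)) ∨
    (∃ i j : ℕ → ℕ, StrictMono i ∧ StrictMono j ∧
      ∀ k : ℕ → ℕ, StrictMono k →
        Tendsto
          (fun n : ℕ => (n : ℝ) ^ (-(1 / p)) * ‖∑ m ∈ Finset.range n, x (i (k m)) (j (k m))‖)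
          atTop (nhds 0)) := by
  have hK0 : 0 ≤ K := hδ.le.trans hδK
  by_cases hI : ∃ j, ∃ ε, 0 < ε ∧ ∀ d, 0 < d → ∃ i, ¬ SmallOnSmallSets (x i j) ε d
  · obtain ⟨j, η, hη, hbad⟩ := hI
    exact Or.inl ⟨j, exists_subsequence_isLqBasisEquiv (f := fun i => x i j) (hcol j) hp1 hp2 hK0 hη
      (fun i => (hnorm i j).2) hbad⟩
  push Not at hI
  refine Or.inr ?_
  by_cases hII : ∃ ε, 0 < ε ∧ ∀ d, 0 < d →
      ∀ᶠ j in (hyperfilter ℕ : Filter ℕ), ∀ᶠ i in (hyperfilter ℕ : Filter ℕ),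
        ¬ SmallOnSmallSets (x i j) ε d
  · obtain ⟨η, hη, hbad⟩ := hII
    obtain ⟨j, d, hj, hbig, hsmall⟩ := exists_greedy_selection
      (fun d j => ∀ᶠ i in (hyperfilter ℕ : Filter ℕ), ¬ SmallOnSmallSets (x i j) η d)
      (fun j ε d => ∀ i, SmallOnSmallSets (x i j) ε d)
      (fun d hd N =>
        (((eventually_gt_atTop N).filter_mono Nat.hyperfilter_le_atTop).and (hbad d hd)).exists)
      hI (fun j ε ε' d d' h hε hd i => (h i).mono hε hd) hη
    refine Or.inl ⟨lqConstant u K p η, one_le_lqConstant hu hK0 hη, fun n => ?_⟩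
    obtain ⟨i, hi⟩ := ((Finset.eventually_all (Finset.range n)).2 fun k _ => hbig k).exists
    refine ⟨i, fun m => j m, fun m m' h => hj h, fun a => ?_⟩
    have h := ((hrow i).comp hj).lq_estimates hu hp1 hp2 hK0 hη (fun m => (hnorm _ _).2) d
      (Finset.range n) hi (fun k l hkl => hsmall k l hkl i)
      (fun k => if hk : k < n then a ⟨k, hk⟩ else 0)
    simp only [Finset.sum_range, Fin.is_lt, dite_true, Fin.eta] at h
    exact h
  push Not at hII
  have hgood : ∀ m : ℕ, ∃ d, 0 < d ∧
      ∀ᶠ j in (hyperfilter ℕ : Filter ℕ), ∀ᶠ i in (hyperfilter ℕ : Filter ℕ),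
        SmallOnSmallSets (x i j) (1 / (m + 1 : ℝ)) d := by
    exact fun m => hII _ (by positivity)
  choose d hd hgood using hgood
  obtain ⟨F, hF, hr⟩ := exists_seq_of_forall_finset_exists
    (fun y : ℕ × ℕ × ℕ => ∀ m ∈ Finset.range y.2.2,
      SmallOnSmallSets (x y.1 y.2.1) (1 / (m + 1 : ℝ)) (d m))
    (fun y z => y.1 < z.1 ∧ y.2.1 < z.2.1 ∧ y.2.2 < z.2.2) (by
      intro s _
      have hlarge : ∀ᶠ j in (hyperfilter ℕ : Filter ℕ), ∀ᶠ i in (hyperfilter ℕ : Filter ℕ),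
          ∀ m ∈ Finset.range (s.sup (fun y => y.2.2) + 1),
            SmallOnSmallSets (x i j) (1 / (m + 1 : ℝ)) (d m) := by
        have := (Finset.eventually_all (Finset.range (s.sup (fun y => y.2.2) + 1))).2
          fun m _ => hgood m
        filter_upwards [this] with j hj
        exact (Finset.eventually_all _).2 hj
      have hgt : ∀ N : ℕ, ∀ᶠ j in (hyperfilter ℕ : Filter ℕ), N < j := fun N =>
        (eventually_gt_atTop N).filter_mono Nat.hyperfilter_le_atTop
      obtain ⟨j, hj, hjN⟩ := (hlarge.and (hgt (s.sup fun y => y.2.1))).exists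
      obtain ⟨i, hi, hiN⟩ := (hj.and (hgt (s.sup fun y => y.1))).exists
      exact ⟨(i, j, _), hi, fun y hy =>
        ⟨(Finset.le_sup (f := fun y : ℕ × ℕ × ℕ => y.1) hy).trans_lt hiN,
          (Finset.le_sup (f := fun y : ℕ × ℕ × ℕ => y.2.1) hy).trans_lt hjN,
          Nat.lt_succ_of_le (Finset.le_sup (f := fun y : ℕ × ℕ × ℕ => y.2.2) hy)⟩⟩)
  have hi : StrictMono fun k => (F k).1 := fun k l hkl => (hr k l hkl).1
  have hj : StrictMono fun k => (F k).2.1 := fun k l hkl => (hr k l hkl).2.1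
  have hstage : StrictMono fun k => (F k).2.2 := fun k l hkl => (hr k l hkl).2.2
  refine Or.inr ⟨_, _, hi, hj, fun k hk => tendsto_norm_sum_of_smallOnSmallSets
    (f := fun m => x (F (k m)).1 (F (k m)).2.1)
    (hdiag _ _ (hi.comp hk) (hj.comp hk)) hp1 hp2 hK0 (fun m => (hnorm _ _).2)
    fun ε hε => ?_⟩
  obtain ⟨m, hm⟩ := exists_nat_one_div_lt hε
  refine ⟨m + 1, d m, hd m, fun l hl => (hF (k l) m ?_).mono hm.le le_rfl⟩
  exact Finset.mem_range.2 (lt_of_lt_of_le hl ((hstage.comp hk).le_apply (x := l)))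

end
end
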